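/- arXiv:2511.06030 — 3 statements merged into one kernel-verified Lean document; each statement's English description precedes it below -/
import Mathlib

section
/- For every α ∈ (0,1) and every x > 0, the profile function Φ satisfies 0 < x·Φ(x) ≤ 4. -/
open Real MeasureTheory Set Filter Topology

noncomputable def bCoef (α : ℝ) (n : ℕ) : ℝ :=
  ∏ i ∈ Finset.range n, Real.Gamma (α * i + i + 2) / Real.Gamma (α * (i + 1) + i + 2)

/-- The profile function `Φ(x) = ∑ bₙ (−x^{1+α}/(1+α))ⁿ`. -/
noncomputable def Phi (α : ℝ) (x : ℝ) : ℝ :=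
  ∑' n : ℕ, bCoef α n * (-(x ^ (1 + α)) / (1 + α)) ^ n

/-- The Caputo fractional derivative of order `α`. -/
noncomputable def caputo (α : ℝ) (f : ℝ → ℝ) (x : ℝ) : ℝ :=
  (1 / Real.Gamma (1 - α)) * ∫ τ in (0:ℝ)..x, deriv f τ * (x - τ) ^ (-α)

/-- The normalizing constant `a₀` with `1/a₀ = 2∫₀^∞ Φ`. -/
noncomputable def a0 (α : ℝ) : ℝ := (2 * ∫ x in Set.Ioi (0:ℝ), Phi α x)⁻¹

/-- The fundamental solution `𝔈_t(x) = a₀ t^{−1/(1+α)} Φ(|x| t^{−1/(1+α)})`. -/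
noncomputable def fundSol (α t x : ℝ) : ℝ :=
  a0 α * t ^ (-1/(1+α)) * Phi α (|x| * t ^ (-1/(1+α)))

noncomputable def C1 (α : ℝ) : ℝ :=
  α * (2:ℝ) ^ (1+α) * max (∫ u in (1/2:ℝ)..1, u ^ (-(1+α)) * (1-u) ^ (α-1)) 2

noncomputable def C2 (α : ℝ) : ℝ := 2 * a0 α * C1 α


lemma beta_real (a s t : ℝ) (ha : 0 < a) (hs : 0 < s) (ht : 0 < t) :
    ∫ x in (0:ℝ)..a, x ^ (s - 1) * (a - x) ^ (t - 1)
      = a ^ (s + t - 1) * (Real.Gamma s * Real.Gamma t / Real.Gamma (s + t)) := by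
  have h := Complex.betaIntegral_scaled (s : ℂ) (t : ℂ) ha
  rw [Complex.betaIntegral_eq_Gamma_mul_div (s:ℂ) (t:ℂ) (by simpa using hs) (by simpa using ht)] at h
  have h2 : ∫ x in (0:ℝ)..a, (x:ℂ) ^ ((s:ℂ) - 1) * ((a:ℂ) - x) ^ ((t:ℂ) - 1)
      = ((∫ x in (0:ℝ)..a, x ^ (s - 1) * (a - x) ^ (t - 1) : ℝ) : ℂ) := by
    rw [← intervalIntegral.integral_ofReal]
    apply intervalIntegral.integral_congr
    intro x hx
    rw [uIcc_of_le ha.le] at hx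
    simp only
    rw [Complex.ofReal_mul, Complex.ofReal_cpow hx.1, Complex.ofReal_cpow (by linarith [hx.2])]
    push_cast
    rfl
  rw [h2] at h
  have h3 : ((a:ℂ) ^ ((s:ℂ) + t - 1)) = ((a ^ (s + t - 1) : ℝ) : ℂ) := by
    rw [Complex.ofReal_cpow ha.le]; push_cast; rfl
  rw [h3, ← Complex.ofReal_add, Complex.Gamma_ofReal, Complex.Gamma_ofReal, Complex.Gamma_ofReal] at h
  exact_mod_cast h

lemma ker_int (α x : ℝ) (hα : α < 1) :
    IntervalIntegrable (fun τ => (x - τ) ^ (-α)) volume 0 x := by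
  have h := (intervalIntegral.intervalIntegrable_rpow' (a := 0) (b := x) (r := -α) (by linarith))
  have := (h.comp_sub_left x).symm
  simpa using this

lemma max_principle (α x : ℝ) (hα : α ∈ Set.Ioo (0:ℝ) 1) (hx : 0 < x) (g g' : ℝ → ℝ)
    (hd : ∀ τ, 0 ≤ τ → HasDerivAt g (g' τ) τ) (hc : ContinuousOn g' (Icc 0 x))
    (hmax : ∀ τ, 0 ≤ τ → τ ≤ x → g τ ≤ g x) :
    (g x - g 0) * x ^ (-α) ≤ ∫ τ in (0:ℝ)..x, g' τ * (x - τ) ^ (-α) := by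
  have hint : IntervalIntegrable (fun τ => g' τ * (x - τ) ^ (-α)) volume 0 x := by
    apply (ker_int α x hα.2).continuousOn_mul
    rwa [uIcc_of_le hx.le]
  have hF : ContinuousOn (fun τ => (g x - g τ) * (x - τ) ^ (-α)) (Icc 0 x) := by
    intro τ hτ
    rcases hτ.2.lt_or_eq with h | h
    · apply ContinuousAt.continuousWithinAt
      apply ContinuousAt.mul
      · exact continuousAt_const.sub (hd τ hτ.1).continuousAt
      · exact (continuousAt_const.sub continuousAt_id).rpow_const (Or.inl (by simp; linarith))
    · subst h
      have hO : (fun t => g t - g τ) =O[𝓝 τ] (fun t => t - τ) := (hd τ hx.le).isBigO_sub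
      obtain ⟨C, hC⟩ := hO.bound
      have h0 : Tendsto (fun t => C * |τ - t| ^ (1 - α)) (𝓝 τ) (𝓝 0) := by
        have : ContinuousAt (fun t => C * |τ - t| ^ (1 - α)) τ := by
          apply ContinuousAt.mul continuousAt_const
          apply ContinuousAt.rpow_const _ (Or.inr (by linarith [hα.2]))
          fun_prop
        have h2 := this.tendsto
        simpa [Real.zero_rpow (show 1 - α ≠ 0 by linarith [hα.2])] using h2
      change Tendsto _ _ _
      simp only [sub_self, zero_mul]
      apply squeeze_zero_norm' _ (h0.mono_left nhdsWithin_le_nhds)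
      filter_upwards [nhdsWithin_le_nhds hC, self_mem_nhdsWithin] with t ht ht2
      rcases ht2.2.lt_or_eq with h3 | h3
      · have hp : 0 < τ - t := by linarith
        rw [norm_mul, abs_of_pos hp, Real.norm_of_nonneg (Real.rpow_nonneg hp.le _), sub_eq_add_neg 1 α,
          Real.rpow_add hp, Real.rpow_one, ← mul_assoc]
        apply mul_le_mul_of_nonneg_right _ (Real.rpow_nonneg hp.le _)
        rw [norm_sub_rev]
        refine ht.trans_eq ?_
        rw [norm_sub_rev, Real.norm_of_nonneg hp.le]
      · subst h3
        simp [Real.zero_rpow (show 1 - α ≠ 0 by linarith [hα.2])]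
  have key := intervalIntegral.integral_le_sub_of_hasDeriv_right_of_le (a := 0) (b := x)
    (g := fun τ => (g x - g τ) * (x - τ) ^ (-α))
    (g' := fun τ => (- g' τ) * (x - τ) ^ (-α) + (g x - g τ) * (-1 * (-α) * (x - τ) ^ (-α - 1)))
    (φ := fun τ => - (g' τ * (x - τ) ^ (-α))) hx.le hF ?_ ?_ ?_
  · simp only [sub_self, zero_mul, sub_zero, zero_sub, intervalIntegral.integral_neg] at key
    linarith
  · intro τ hτ
    apply HasDerivAt.hasDerivWithinAt
    apply HasDerivAt.mul
    · exact (hd τ hτ.1.le).const_sub _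
    · exact ((hasDerivAt_id τ).const_sub x).rpow_const (Or.inl (by simp; linarith [hτ.2]))
  · have := (intervalIntegrable_iff_integrableOn_Icc_of_le hx.le).1 hint
    exact this.neg
  · intro τ hτ
    have h1 : 0 ≤ g x - g τ := by linarith [hmax τ hτ.1.le hτ.2.le]
    have h2 : 0 ≤ (x - τ) ^ (-α - 1) := Real.rpow_nonneg (by linarith [hτ.2]) _
    have h3 : 0 ≤ (g x - g τ) * (-1 * (-α) * (x - τ) ^ (-α - 1)) := by
      have := hα.1
      have : -1 * (-α) = α := by ring
      rw [this]; positivity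
    linarith

lemma gamma_low (α : ℝ) (hα : α ∈ Set.Ioo (0:ℝ) 1) : 1 / (1 + α) ≤ Real.Gamma (2 - α) := by
  obtain ⟨h0, h1⟩ := hα
  have e := Real.Gamma_mul_add_mul_le_rpow_Gamma_mul_rpow_Gamma (s := 2 - α) (t := 2 + α)
    (a := 1/2) (b := 1/2) (by linarith) (by linarith) (by norm_num) (by norm_num) (by norm_num)
  have e2 : (1/2:ℝ) * (2 - α) + 1/2 * (2 + α) = 2 := by ring
  rw [e2, Real.Gamma_two] at e
  have p1 : 0 < Real.Gamma (2 - α) := Real.Gamma_pos_of_pos (by linarith)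
  have p2 : 0 < Real.Gamma (2 + α) := Real.Gamma_pos_of_pos (by linarith)
  rw [← Real.mul_rpow p1.le p2.le, ← Real.sqrt_eq_rpow, Real.one_le_sqrt] at e
  have e3 : Real.Gamma (2 + α) ≤ 1 + α := by
    have q := Real.convexOn_Gamma.2 (show (1:ℝ) ∈ Ioi 0 by simp) (show (2:ℝ) ∈ Ioi 0 by simp)
      (show 0 ≤ 1 - α by linarith) h0.le (by ring)
    simp only [smul_eq_mul, Real.Gamma_one, Real.Gamma_two] at q
    have : (1 - α) * 1 + α * 2 = 1 + α := by ring
    rw [this, mul_one, mul_one] at q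
    have : 2 + α = (1 + α) + 1 := by ring
    rw [this, Real.Gamma_add_one (by linarith)]
    nlinarith
  rw [div_le_iff₀ (by linarith)]
  nlinarith

lemma gamma_ratio (α s : ℝ) (hα : α ∈ Set.Ioo (0:ℝ) 1) (hs : 1 ≤ s) :
    Real.Gamma s / Real.Gamma (s + α) ≤ 2 * s ^ (-α) := by
  obtain ⟨h0, h1⟩ := hα
  have p1 : 0 < Real.Gamma s := Real.Gamma_pos_of_pos (by linarith)
  have p2 : 0 < Real.Gamma (s + α) := Real.Gamma_pos_of_pos (by linarith)
  have e := Real.Gamma_mul_add_mul_le_rpow_Gamma_mul_rpow_Gamma (s := s + α) (t := s + α + 1)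
    (a := α) (b := 1 - α) (by linarith) (by linarith) h0 (by linarith) (by ring)
  have e2 : α * (s + α) + (1 - α) * (s + α + 1) = s + 1 := by ring
  rw [e2, Real.Gamma_add_one (by linarith), Real.Gamma_add_one (by linarith),
    Real.mul_rpow (by linarith) p2.le, mul_left_comm, ← Real.rpow_add p2] at e
  have e3 : α + (1 - α) = 1 := by ring
  rw [e3, Real.rpow_one] at e
  have e4 : (s + α) ^ (1 - α) ≤ 2 * s ^ (1 - α) := by
    calc (s + α) ^ (1 - α) ≤ (2 * s) ^ (1 - α) :=
          Real.rpow_le_rpow (by linarith) (by linarith) (by linarith)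
      _ = 2 ^ (1 - α) * s ^ (1 - α) := Real.mul_rpow (by norm_num) (by linarith)
      _ ≤ 2 * s ^ (1 - α) := by
          apply mul_le_mul_of_nonneg_right _ (Real.rpow_nonneg (by linarith) _)
          calc (2:ℝ) ^ (1 - α) ≤ 2 ^ (1:ℝ) :=
                Real.rpow_le_rpow_of_exponent_le (by norm_num) (by linarith)
            _ = 2 := by simp
  have e5 : s ^ (1 - α) = s * s ^ (-α) := by
    rw [sub_eq_add_neg, Real.rpow_add (by linarith), Real.rpow_one]
  rw [div_le_iff₀ p2]
  have e6 : s * Real.Gamma s ≤ s * (2 * s ^ (-α) * Real.Gamma (s + α)) := by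
    refine e.trans ?_
    rw [e5] at e4
    calc _ ≤ (2 * (s * s ^ (-α))) * Real.Gamma (s + α) := by gcongr
      _ = _ := by ring
  exact le_of_mul_le_mul_left e6 (by linarith)

lemma bCoef_pos (α : ℝ) (hα : α ∈ Set.Ioo (0:ℝ) 1) (n : ℕ) : 0 < bCoef α n := by
  have := hα.1
  apply Finset.prod_pos
  intro i _
  apply div_pos <;> apply Real.Gamma_pos_of_pos <;> positivity

lemma bCoef_succ (α : ℝ) (n : ℕ) : bCoef α (n + 1) =
    bCoef α n * (Real.Gamma (α * n + n + 2) / Real.Gamma (α * (n + 1) + n + 2)) := by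
  rw [bCoef, Finset.prod_range_succ]; rfl

lemma summ_b (α : ℝ) (hα : α ∈ Set.Ioo (0:ℝ) 1) (R : ℝ) (hR : 0 < R) :
    Summable (fun n => bCoef α n * R ^ n) := by
  have hb := bCoef_pos α hα
  apply summable_of_ratio_test_tendsto_lt_one (l := 0) (by norm_num)
  · exact Eventually.of_forall fun n => (mul_pos (hb n) (by positivity)).ne'
  · have h1 : Tendsto (fun n : ℕ => (2 * R) * ((n:ℝ) ) ^ (-α)) atTop (𝓝 0) := by
      have := ((tendsto_rpow_neg_atTop hα.1).comp tendsto_natCast_atTop_atTop).const_mul (2 * R)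
      simpa using! this
    refine squeeze_zero' (Eventually.of_forall fun n => by positivity) ?_ h1
    filter_upwards [eventually_ge_atTop 1] with n hn
    have hn' : (1:ℝ) ≤ n := by exact_mod_cast hn
    have ha := hα.1
    have hbn := hb n
    rw [Real.norm_of_nonneg (mul_pos (hb _) (by positivity)).le,
      Real.norm_of_nonneg (mul_pos (hb _) (by positivity)).le, bCoef_succ]
    have e : α * (n + 1) + n + 2 = (α * n + n + 2) + α := by ring
    rw [e]
    have g := gamma_ratio α (α * n + n + 2) hα (by nlinarith)
    have g2 : (α * n + n + 2) ^ (-α) ≤ (n:ℝ) ^ (-α) :=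
      Real.rpow_le_rpow_of_nonpos (by linarith) (by nlinarith) (by linarith)
    set q := Real.Gamma (α * n + n + 2) / Real.Gamma (α * n + n + 2 + α)
    have : bCoef α n * q * R ^ (n + 1) / (bCoef α n * R ^ n) = R * q := by
      field_simp
      ring
    rw [this]
    nlinarith

lemma summ_nb (α : ℝ) (hα : α ∈ Set.Ioo (0:ℝ) 1) (R : ℝ) (hR : 0 < R) :
    Summable (fun n : ℕ => bCoef α n * (n * R ^ (n - 1))) := by
  have hb := bCoef_pos α hα
  have h := (summ_b α hα (2 * R) (by positivity)).mul_left R⁻¹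
  refine Summable.of_nonneg_of_le (fun n => by have := hb n; positivity) (fun n => ?_) h
  have hbn := hb n
  have : (n:ℝ) * R ^ (n - 1) ≤ R⁻¹ * (2 * R) ^ n := by
    rcases n with _ | n
    · simp; positivity
    · rw [mul_pow, pow_succ R, Nat.add_sub_cancel]
      have : ((n + 1 : ℕ):ℝ) ≤ 2 ^ (n + 1) := by exact_mod_cast (Nat.lt_two_pow_self).le
      have e : R⁻¹ * (2 ^ (n + 1) * (R ^ n * R)) = 2 ^ (n + 1) * R ^ n := by field_simp
      rw [e]; gcongr
  calc _ ≤ bCoef α n * (R⁻¹ * (2 * R) ^ n) := by gcongr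
    _ = _ := by ring

/-- derivative series -/
noncomputable def Qser (α z : ℝ) : ℝ := ∑' n : ℕ, bCoef α n * (n * z ^ (n - 1))

lemma hasDeriv_P (α : ℝ) (hα : α ∈ Set.Ioo (0:ℝ) 1) (z : ℝ) :
    HasDerivAt (fun z => ∑' n : ℕ, bCoef α n * z ^ n) (Qser α z) z := by
  have hR : 0 < |z| + 1 := by positivity
  refine hasDerivAt_tsum_of_isPreconnected (summ_nb α hα (|z| + 1) hR) (t := Metric.ball 0 (|z| + 1))
    (y₀ := 0) (g := fun (n : ℕ) z => bCoef α n * z ^ n)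
    (g' := fun (n : ℕ) z => bCoef α n * (n * z ^ (n - 1)))
    Metric.isOpen_ball (convex_ball _ _).isPreconnected ?_ ?_ ?_ ?_ ?_
  · intro n y _
    exact (hasDerivAt_pow n y).const_mul _
  · intro n y hy
    have hb := bCoef_pos α hα n
    rw [mem_ball_zero_iff] at hy
    rw [norm_mul, norm_mul, norm_pow, Real.norm_of_nonneg hb.le, Real.norm_natCast]
    gcongr
  · simpa using hR
  · apply summable_of_ne_finset_zero (s := {0})
    intro n hn
    simp at hn
    simp [hn]
  · simp

lemma cont_Q (α : ℝ) (hα : α ∈ Set.Ioo (0:ℝ) 1) : Continuous (Qser α) := by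
  rw [continuous_iff_continuousAt]
  intro z
  have hR : 0 < |z| + 1 := by positivity
  have : ContinuousOn (Qser α) (Metric.ball 0 (|z| + 1)) := by
    apply continuousOn_tsum _ (summ_nb α hα (|z| + 1) hR)
    · intro n y hy
      have hb := bCoef_pos α hα n
      rw [mem_ball_zero_iff] at hy
      rw [norm_mul, norm_mul, norm_pow, Real.norm_of_nonneg hb.le, Real.norm_natCast]
      gcongr
    · intro n
      fun_prop
  exact this.continuousAt (Metric.isOpen_ball.mem_nhds (by simp))

/-- the derivative of the profile -/
noncomputable def dPhi (α x : ℝ) : ℝ := Qser α (-(x ^ (1 + α)) / (1 + α)) * (-(x ^ α))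

lemma hasDeriv_Phi (α : ℝ) (hα : α ∈ Set.Ioo (0:ℝ) 1) (x : ℝ) :
    HasDerivAt (Phi α) (dPhi α x) x := by
  have h0 := hα.1
  have h1 : HasDerivAt (fun x : ℝ => -(x ^ (1 + α)) / (1 + α)) (-(x ^ α)) x := by
    have := ((Real.hasDerivAt_rpow_const (x := x) (p := 1 + α) (Or.inr (by linarith))).neg).div_const
      (1 + α)
    convert! this using 1
    have e : 1 + α - 1 = α := by ring
    rw [e]
    field_simp
  exact (hasDeriv_P α hα (-(x ^ (1 + α)) / (1 + α))).comp x h1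

lemma cont_dPhi (α : ℝ) (hα : α ∈ Set.Ioo (0:ℝ) 1) : Continuous (dPhi α) := by
  have h0 := hα.1
  have h1 : Continuous (fun x : ℝ => x ^ α) := continuous_id.rpow_const (fun _ => Or.inr h0.le)
  have h2 : Continuous (fun x : ℝ => x ^ (1 + α)) :=
    continuous_id.rpow_const (fun _ => Or.inr (by linarith))
  exact ((cont_Q α hα).comp (h2.neg.div_const _)).mul h1.neg

lemma Phi_zero (α : ℝ) (hα : α ∈ Set.Ioo (0:ℝ) 1) : Phi α 0 = 1 := by
  have h0 := hα.1
  rw [Phi, tsum_eq_single 0]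
  · simp [bCoef]
  · intro n hn
    rw [Real.zero_rpow (by linarith)]
    simp [hn]

lemma caputo_Phi (α : ℝ) (hα : α ∈ Set.Ioo (0:ℝ) 1) (x : ℝ) (hx : 0 < x) :
    ∫ τ in (0:ℝ)..x, dPhi α τ * (x - τ) ^ (-α)
      = - (Real.Gamma (1 - α) / (1 + α)) * x * Phi α x := by
  obtain ⟨h0, h1⟩ := id hα
  have hb := bCoef_pos α hα
  have hG : 0 < Real.Gamma (1 - α) := Real.Gamma_pos_of_pos (by linarith)
  let p : ℕ → ℝ := fun i => (1 + α) * i + α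
  let A : ℕ → ℝ := fun i => bCoef α (i + 1) * (i + 1) * (1 / (1 + α)) ^ i
  let F : ℕ → ℝ → ℝ := fun i τ => (-1) ^ (i + 1) * A i * (τ ^ p i * (x - τ) ^ (-α))
  have hp : ∀ i, 0 < p i := fun i => by positivity
  have hA : ∀ i, 0 < A i := fun i => by have := hb (i + 1); positivity
  have hI : ∀ i, A i * ∫ τ in (0:ℝ)..x, τ ^ p i * (x - τ) ^ (-α)
      = Real.Gamma (1 - α) / (1 + α) * x * (bCoef α i * (x ^ (1 + α) / (1 + α)) ^ i) := by
    intro i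
    have h := beta_real x (p i + 1) (1 - α) hx (by linarith [hp i]) (by linarith)
    have e1 : p i + 1 - 1 = p i := by ring
    have e2 : 1 - α - 1 = -α := by ring
    have e3 : p i + 1 + (1 - α) - 1 = 1 + (1 + α) * i := by simp only [p]; ring
    have e4 : p i + 1 + (1 - α) = α * i + i + 2 := by simp only [p]; ring
    have e5 : α * (i + 1) + i + 2 = (p i + 1) + 1 := by simp only [p]; ring
    rw [e1, e2, e3, e4] at h
    have hg1 : 0 < Real.Gamma (p i + 1) := Real.Gamma_pos_of_pos (by linarith [hp i])
    have hg2 : 0 < Real.Gamma (α * i + i + 2) := Real.Gamma_pos_of_pos (by positivity)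
    have e6 : x ^ (1 + (1 + α) * i) = x * (x ^ (1 + α)) ^ i := by
      rw [Real.rpow_add hx, Real.rpow_one, Real.rpow_mul hx.le, Real.rpow_natCast]
    have e7 : p i + 1 = (1 + α) * (i + 1) := by simp only [p]; ring
    rw [h, e6]
    simp only [A]
    rw [bCoef_succ, e5, Real.Gamma_add_one (by linarith [hp i]), div_pow, div_pow, one_pow]
    have hpi : p i + 1 ≠ 0 := by linarith [hp i]
    generalize Real.Gamma (p i + 1) = u at *
    rw [e7]
    field_simp
  have hint : ∀ i, IntervalIntegrable (fun τ => τ ^ p i * (x - τ) ^ (-α)) volume 0 x := by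
    intro i
    apply (ker_int α x h1).continuousOn_mul
    exact (continuous_id.rpow_const (fun _ => Or.inr (hp i).le)).continuousOn
  have hintF : ∀ i, Integrable (F i) (volume.restrict (Ioc 0 x)) := by
    intro i
    exact ((intervalIntegrable_iff_integrableOn_Ioc_of_le hx.le).1 (hint i)).const_mul _
  have hnorm : ∀ i, ∫ τ, ‖F i τ‖ ∂(volume.restrict (Ioc 0 x))
      = Real.Gamma (1 - α) / (1 + α) * x * (bCoef α i * (x ^ (1 + α) / (1 + α)) ^ i) := by
    intro i
    rw [← hI i, intervalIntegral.integral_of_le hx.le, ← integral_const_mul]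
    apply setIntegral_congr_fun measurableSet_Ioc
    intro τ hτ
    have q1 : 0 ≤ τ ^ p i * (x - τ) ^ (-α) :=
      mul_nonneg (Real.rpow_nonneg hτ.1.le _) (Real.rpow_nonneg (by linarith [hτ.2]) _)
    simp only [F]
    rw [norm_mul, norm_mul, norm_pow, norm_neg, norm_one, one_pow, one_mul,
      Real.norm_of_nonneg (hA i).le, Real.norm_of_nonneg q1]
  have hval : ∀ i, ∫ τ, F i τ ∂(volume.restrict (Ioc 0 x))
      = - (Real.Gamma (1 - α) / (1 + α)) * x * (bCoef α i * (-(x ^ (1 + α)) / (1 + α)) ^ i) := by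
    intro i
    simp only [F]
    rw [integral_const_mul, ← intervalIntegral.integral_of_le hx.le, mul_assoc, hI i,
      neg_div, neg_pow (x ^ (1 + α) / (1 + α)), pow_succ]
    ring
  have hs : Summable fun i => ∫ τ, ‖F i τ‖ ∂(volume.restrict (Ioc 0 x)) := by
    simp_rw [hnorm]
    exact (summ_b α hα _ (by positivity)).mul_left _
  have key := integral_tsum_of_summable_integral_norm hintF hs
  simp_rw [hval] at key
  rw [tsum_mul_left] at key
  rw [Phi, key, intervalIntegral.integral_of_le hx.le]
  apply setIntegral_congr_fun measurableSet_Ioc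
  intro τ hτ
  have hτ0 := hτ.1
  have hsum : Summable (fun n : ℕ => bCoef α n * (n * (-(τ ^ (1 + α)) / (1 + α)) ^ (n - 1))) := by
    apply Summable.of_norm
    refine (summ_nb α hα (τ ^ (1 + α) / (1 + α)) (by positivity)).congr ?_
    intro n
    rw [norm_mul, norm_mul, norm_pow, Real.norm_of_nonneg (hb n).le, Real.norm_natCast, neg_div,
      norm_neg, Real.norm_of_nonneg (by positivity)]
  simp only [dPhi, Qser]
  rw [hsum.tsum_eq_zero_add]
  simp only [Nat.cast_zero, zero_mul, mul_zero, zero_add, Nat.add_sub_cancel]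
  rw [← tsum_mul_right, ← tsum_mul_right]
  congr 1
  ext i
  simp only [F, A, p]
  rw [Real.rpow_add hτ0 ((1 + α) * i) α, Real.rpow_mul hτ0.le (1 + α) i, Real.rpow_natCast, neg_div,
    neg_pow (τ ^ (1 + α) / (1 + α)), pow_succ, div_pow, div_pow, one_pow]
  push_cast
  field_simp

lemma Phi_pos (α : ℝ) (hα : α ∈ Set.Ioo (0:ℝ) 1) (x : ℝ) (hx : 0 ≤ x) : 0 < Phi α x := by
  by_contra hcon
  push Not at hcon
  have hcont : Continuous (Phi α) :=
    continuous_iff_continuousAt.2 fun z => (hasDeriv_Phi α hα z).continuousAt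
  have hK : IsCompact (Icc 0 x ∩ {t | Phi α t ≤ 0}) :=
    isCompact_Icc.inter_right (isClosed_le hcont continuous_const)
  obtain ⟨y, hy, hmin⟩ := hK.exists_isLeast ⟨x, ⟨hx, le_rfl⟩, hcon⟩
  have hy0 : Phi α y ≤ 0 := hy.2
  have hypos : 0 < y := by
    rcases hy.1.1.lt_or_eq with h | h
    · exact h
    · rw [← h, Phi_zero α hα] at hy0; linarith
  have hbefore : ∀ τ, 0 ≤ τ → τ < y → 0 < Phi α τ := by
    intro τ h1 h2
    by_contra h3
    push Not at h3
    have := hmin ⟨⟨h1, by linarith [hy.1.2]⟩, h3⟩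
    linarith
  have key := max_principle α y hα hypos (fun t => - Phi α t) (fun t => - dPhi α t)
    (fun τ _ => (hasDeriv_Phi α hα τ).neg) (cont_dPhi α hα).neg.continuousOn (by
      intro τ h1 h2
      rcases h2.lt_or_eq with h | h
      · have := hbefore τ h1 h
        linarith
      · rw [h])
  simp only [neg_mul, intervalIntegral.integral_neg] at key
  rw [caputo_Phi α hα y hypos, Phi_zero α hα] at key
  have hG : 0 < Real.Gamma (1 - α) := Real.Gamma_pos_of_pos (by linarith [hα.2])
  have h5 : 0 < y ^ (-α) := Real.rpow_pos_of_pos hypos _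
  have h6 : 0 < Real.Gamma (1 - α) / (1 + α) * y := by
    have := hα.1
    positivity
  have h7 : Real.Gamma (1 - α) / (1 + α) * y * Phi α y ≤ 0 :=
    mul_nonpos_of_nonneg_of_nonpos h6.le hy0
  have h8 : 0 < (-Phi α y - -1) * y ^ (-α) := mul_pos (by linarith) h5
  linarith

lemma Phi_le_one (α : ℝ) (hα : α ∈ Set.Ioo (0:ℝ) 1) (x : ℝ) (hx : 0 ≤ x) : Phi α x ≤ 1 := by
  by_contra hcon
  push Not at hcon
  have hcont : Continuous (Phi α) :=
    continuous_iff_continuousAt.2 fun z => (hasDeriv_Phi α hα z).continuousAt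
  obtain ⟨y, hy, hmax⟩ := (isCompact_Icc (a := 0) (b := x)).exists_isMaxOn ⟨x, ⟨hx, le_rfl⟩⟩
    hcont.continuousOn
  have hmax' : ∀ τ, 0 ≤ τ → τ ≤ x → Phi α τ ≤ Phi α y := fun τ h1 h2 => hmax ⟨h1, h2⟩
  have hy0 : 1 < Phi α y := lt_of_lt_of_le hcon (hmax' x hx le_rfl)
  have hypos : 0 < y := by
    rcases hy.1.lt_or_eq with h | h
    · exact h
    · rw [← h, Phi_zero α hα] at hy0; linarith
  have key := max_principle α y hα hypos (Phi α) (dPhi α)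
    (fun τ _ => hasDeriv_Phi α hα τ) (cont_dPhi α hα).continuousOn
    (fun τ h1 h2 => hmax' τ h1 (h2.trans hy.2))
  rw [caputo_Phi α hα y hypos, Phi_zero α hα] at key
  have hG : 0 < Real.Gamma (1 - α) := Real.Gamma_pos_of_pos (by linarith [hα.2])
  have h5 : 0 < y ^ (-α) := Real.rpow_pos_of_pos hypos _
  have h6 : 0 < Real.Gamma (1 - α) / (1 + α) * y := by
    have := hα.1
    positivity
  have h7 : 0 < Real.Gamma (1 - α) / (1 + α) * y * Phi α y := mul_pos h6 (by linarith)
  have h8 : 0 < (Phi α y - 1) * y ^ (-α) := mul_pos (by linarith) h5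
  linarith

lemma poly_ineq (a h : ℝ) (h0 : 0 < a) (h1 : a < 1) (hh : 1 ≤ h) :
    ((1 - a) * (2 + h) + 2) * (1 + h) * (1 + a) ^ 2 < 2 * (2 + h) ^ 2 := by
  obtain ⟨H, rfl⟩ : ∃ H, h = 1 + H := ⟨h - 1, by ring⟩
  have hH : 0 ≤ H := by linarith
  have c2 : (1 - a) * (1 + a) ^ 2 ≤ 2 := by nlinarith [sq_nonneg (a - 1/3), mul_pos h0 h0]
  have c1 : (7 - 5 * a) * (1 + a) ^ 2 ≤ 12 := by
    nlinarith [mul_nonneg h0.le (sq_nonneg (a - 3/5)), sq_nonneg (a - 3/5)]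
  have c0 : 2 * (5 - 3 * a) * (1 + a) ^ 2 < 18 := by
    nlinarith [mul_nonneg h0.le (sq_nonneg (a - 7/9)), sq_nonneg (a - 7/9)]
  have t1 := mul_le_mul_of_nonneg_right c1 hH
  have t2 := mul_le_mul_of_nonneg_right c2 (mul_nonneg hH hH)
  nlinarith

lemma barrier_int (α x : ℝ) (hα : α ∈ Set.Ioo (0:ℝ) 1) (a b : ℝ) (ha : 0 ≤ a) (hab : a ≤ b)
    (hb : b ≤ x) :
    IntervalIntegrable (fun τ => ((2 + τ) ^ 2)⁻¹ * (x - τ) ^ (-α)) volume a b := by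
  have h : IntervalIntegrable (fun τ => ((2 + τ) ^ 2)⁻¹ * (x - τ) ^ (-α)) volume 0 x := by
    apply (ker_int α x hα.2).continuousOn_mul
    rw [uIcc_of_le (by linarith)]
    apply ContinuousOn.inv₀ (by fun_prop)
    intro τ hτ
    have : 0 < 2 + τ := by linarith [hτ.1]
    positivity
  apply h.mono_set
  rw [uIcc_of_le hab, uIcc_of_le (by linarith)]
  exact Icc_subset_Icc ha hb

lemma barrier (α x : ℝ) (hα : α ∈ Set.Ioo (0:ℝ) 1) (hx : 2 ≤ x) :
    ∫ τ in (0:ℝ)..x, ((2 + τ) ^ 2)⁻¹ * (x - τ) ^ (-α)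
      < Real.Gamma (1 - α) / (1 + α) * x * (2 + x)⁻¹ := by
  obtain ⟨h0, h1⟩ := id hα
  obtain ⟨h, rfl⟩ : ∃ h, x = 2 * h := ⟨x / 2, by ring⟩
  have hh : 1 ≤ h := by linarith
  have i1 := barrier_int α (2 * h) hα 0 h le_rfl (by linarith) (by linarith)
  have i2 := barrier_int α (2 * h) hα h (2 * h) (by linarith) (by linarith) le_rfl
  have hk : 0 < h ^ (-α) := Real.rpow_pos_of_pos (by linarith) _
  have hk1 : h ^ (-α) ≤ 1 := Real.rpow_le_one_of_one_le_of_nonpos hh (by linarith)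
  rw [← intervalIntegral.integral_add_adjacent_intervals i1 i2]
  have b1 : ∫ τ in (0:ℝ)..h, ((2 + τ) ^ 2)⁻¹ * (2 * h - τ) ^ (-α)
      ≤ h ^ (-α) * (1 / 2 - 1 / (2 + h)) := by
    have := intervalIntegral.integral_le_sub_of_hasDeriv_right_of_le (a := 0) (b := h)
      (g := fun τ => h ^ (-α) * (-(2 + τ)⁻¹)) (g' := fun τ => h ^ (-α) * (-(-1 / (2 + τ) ^ 2)))
      (φ := fun τ => ((2 + τ) ^ 2)⁻¹ * (2 * h - τ) ^ (-α)) (by linarith) ?_ ?_ ?_ ?_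
    · refine this.trans_eq ?_
      simp only [one_div]; ring
    · apply continuousOn_const.mul
      apply ContinuousOn.neg
      apply ContinuousOn.inv₀ (by fun_prop)
      intro τ hτ
      linarith [hτ.1]
    · intro τ hτ
      apply HasDerivAt.hasDerivWithinAt
      exact ((((hasDerivAt_id τ).const_add 2).fun_inv (by simp; linarith [hτ.1])).neg).const_mul _
    · exact (intervalIntegrable_iff_integrableOn_Icc_of_le (by linarith)).1 i1
    · intro τ hτ
      have : 0 < 2 + τ := by linarith [hτ.1]
      have e : h ^ (-α) * (-(-1 / (2 + τ) ^ 2)) = ((2 + τ) ^ 2)⁻¹ * h ^ (-α) := by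
        field_simp
      rw [e]
      apply mul_le_mul_of_nonneg_left _ (by positivity)
      exact Real.rpow_le_rpow_of_nonpos (by linarith) (by linarith [hτ.2]) (by linarith)
  have b2 : ∫ τ in h..(2*h), ((2 + τ) ^ 2)⁻¹ * (2 * h - τ) ^ (-α)
      ≤ ((2 + h) ^ 2)⁻¹ * (h * h ^ (-α) / (1 - α)) := by
    have := intervalIntegral.integral_le_sub_of_hasDeriv_right_of_le (a := h) (b := 2 * h)
      (g := fun τ => ((2 + h) ^ 2)⁻¹ / (1 - α) * (-((2 * h - τ) ^ (1 - α))))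
      (g' := fun τ => ((2 + h) ^ 2)⁻¹ / (1 - α) *
        (-(-1 * (1 - α) * (2 * h - τ) ^ (1 - α - 1))))
      (φ := fun τ => ((2 + τ) ^ 2)⁻¹ * (2 * h - τ) ^ (-α)) (by linarith) ?_ ?_ ?_ ?_
    · refine this.trans_eq ?_
      have e1 : 2 * h - h = h := by ring
      have e2 : h ^ (1 - α) = h * h ^ (-α) := by
        rw [sub_eq_add_neg, Real.rpow_add (by linarith), Real.rpow_one]
      simp only [sub_self]
      rw [Real.zero_rpow (by linarith), e1, e2]
      ring
    · apply continuousOn_const.mul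
      apply ContinuousOn.neg
      exact ContinuousOn.rpow_const (by fun_prop) (fun _ _ => Or.inr (by linarith))
    · intro τ hτ
      apply HasDerivAt.hasDerivWithinAt
      exact ((((hasDerivAt_id τ).const_sub (2 * h)).rpow_const
        (Or.inl (by simp; linarith [hτ.2]))).neg).const_mul _
    · exact (intervalIntegrable_iff_integrableOn_Icc_of_le (by linarith)).1 i2
    · intro τ hτ
      have ht : 0 < 2 + τ := by linarith [hτ.1]
      have ha : 1 - α ≠ 0 := by linarith
      have e0 : 1 - α - 1 = -α := by ring
      have e : ((2 + h) ^ 2)⁻¹ / (1 - α) * (-(-1 * (1 - α) * (2 * h - τ) ^ (1 - α - 1)))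
          = ((2 + h) ^ 2)⁻¹ * (2 * h - τ) ^ (-α) := by
        rw [e0]; field_simp
      rw [e]
      apply mul_le_mul_of_nonneg_right _ (Real.rpow_nonneg (by linarith [hτ.2]) _)
      apply inv_anti₀ (by positivity)
      have := hτ.1
      gcongr
  have hG : Real.Gamma (2 - α) = (1 - α) * Real.Gamma (1 - α) := by
    rw [← Real.Gamma_add_one (by linarith)]; congr 1; ring
  have hlow := gamma_low α hα
  rw [hG] at hlow
  have ha : 0 < 1 - α := by linarith
  have hGlow : 1 / ((1 + α) * (1 - α)) ≤ Real.Gamma (1 - α) := by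
    rw [← div_div, div_le_iff₀ ha]; linarith
  have hp := poly_ineq α h h0 h1 hh
  have b1' : h ^ (-α) * (1 / 2 - 1 / (2 + h)) ≤ 1 / 2 - 1 / (2 + h) := by
    have : 0 ≤ 1 / 2 - 1 / (2 + h) := by
      rw [sub_nonneg]
      exact one_div_le_one_div_of_le (by norm_num) (by linarith)
    nlinarith
  have b2' : ((2 + h) ^ 2)⁻¹ * (h * h ^ (-α) / (1 - α)) ≤ ((2 + h) ^ 2)⁻¹ * (h / (1 - α)) := by
    gcongr
    nlinarith
  have fin : 1 / 2 - 1 / (2 + h) + ((2 + h) ^ 2)⁻¹ * (h / (1 - α))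
      < 1 / ((1 + α) * (1 - α)) / (1 + α) * (2 * h) * (2 + 2 * h)⁻¹ := by
    have e1 : 1 / 2 - 1 / (2 + h) + ((2 + h) ^ 2)⁻¹ * (h / (1 - α))
        = h * ((1 - α) * (2 + h) + 2) / (2 * (2 + h) ^ 2 * (1 - α)) := by
      field_simp; ring
    have e2 : 1 / ((1 + α) * (1 - α)) / (1 + α) * (2 * h) * (2 + 2 * h)⁻¹
        = h / ((1 + α) ^ 2 * (1 - α) * (1 + h)) := by
      field_simp
    rw [e1, e2, div_lt_div_iff₀ (by positivity) (by positivity)]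
    have := mul_lt_mul_of_pos_left hp (mul_pos (show 0 < h by linarith) ha)
    nlinarith
  have fin2 : 1 / ((1 + α) * (1 - α)) / (1 + α) * (2 * h) * (2 + 2 * h)⁻¹
      ≤ Real.Gamma (1 - α) / (1 + α) * (2 * h) * (2 + 2 * h)⁻¹ := by
    gcongr
  linarith

lemma Phi_le_barrier (α : ℝ) (hα : α ∈ Set.Ioo (0:ℝ) 1) (x : ℝ) (hx : 0 ≤ x) :
    Phi α x ≤ 4 * (2 + x)⁻¹ := by
  by_contra hcon
  push Not at hcon
  have hcont : Continuous (Phi α) :=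
    continuous_iff_continuousAt.2 fun z => (hasDeriv_Phi α hα z).continuousAt
  have hcl : IsClosed {t | t ∈ Icc 0 x ∧ 4 * (2 + t)⁻¹ ≤ Phi α t} := by
    apply isClosed_Icc.isClosed_le _ hcont.continuousOn
    apply continuousOn_const.mul
    apply ContinuousOn.inv₀ (by fun_prop)
    intro τ hτ
    linarith [hτ.1]
  have hK : IsCompact {t | t ∈ Icc 0 x ∧ 4 * (2 + t)⁻¹ ≤ Phi α t} :=
    isCompact_Icc.of_isClosed_subset hcl (fun t ht => ht.1)
  obtain ⟨y, hy, hmin⟩ := hK.exists_isLeast ⟨x, ⟨hx, le_rfl⟩, hcon.le⟩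
  have hy0 : 4 * (2 + y)⁻¹ ≤ Phi α y := hy.2
  have hy1 := Phi_le_one α hα y hy.1.1
  have hy2 : 2 ≤ y := by
    have hp : 0 < 2 + y := by linarith [hy.1.1]
    have h4 := hy0.trans hy1
    rw [← div_eq_mul_inv, div_le_one hp] at h4
    linarith
  have hypos : 0 < y := by linarith
  have hbefore : ∀ τ, 0 ≤ τ → τ < y → Phi α τ < 4 * (2 + τ)⁻¹ := by
    intro τ h1 h2
    by_contra h3
    push Not at h3
    have := hmin ⟨⟨h1, by linarith [hy.1.2]⟩, h3⟩
    linarith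
  have key := max_principle α y hα hypos (fun t => Phi α t - 4 * (2 + t)⁻¹)
    (fun t => dPhi α t - 4 * (-1 / (2 + t) ^ 2))
    (fun τ hτ => (hasDeriv_Phi α hα τ).sub
      ((((hasDerivAt_id τ).const_add 2).fun_inv (by simp; linarith)).const_mul 4)) (by
      apply (cont_dPhi α hα).continuousOn.sub
      apply continuousOn_const.mul
      apply ContinuousOn.div (by fun_prop) (by fun_prop)
      intro τ hτ
      have : 0 < 2 + τ := by linarith [hτ.1]
      positivity) (by
      intro τ h1 h2
      rcases h2.lt_or_eq with h | h
      · have := hbefore τ h1 h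
        linarith
      · rw [h])
  have e : ∀ τ, (dPhi α τ - 4 * (-1 / (2 + τ) ^ 2)) * (y - τ) ^ (-α)
      = dPhi α τ * (y - τ) ^ (-α) + 4 * (((2 + τ) ^ 2)⁻¹ * (y - τ) ^ (-α)) := by
    intro τ; ring
  simp only [e] at key
  rw [intervalIntegral.integral_add
    ((ker_int α y hα.2).continuousOn_mul (cont_dPhi α hα).continuousOn)
    ((barrier_int α y hα 0 y le_rfl hypos.le le_rfl).const_mul 4),
    intervalIntegral.integral_const_mul, caputo_Phi α hα y hypos, Phi_zero α hα] at key
  have hb := barrier α y hα hy2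
  have hG : 0 < Real.Gamma (1 - α) := Real.Gamma_pos_of_pos (by linarith [hα.2])
  have h5 : 0 < y ^ (-α) := Real.rpow_pos_of_pos hypos _
  have h6 : 0 < Real.Gamma (1 - α) / (1 + α) * y := by
    have := hα.1
    positivity
  have h7 := mul_le_mul_of_nonneg_left hy0 h6.le
  have h8 : 0 ≤ (Phi α y - 4 * (2 + y)⁻¹ - (1 - 4 * (2 + 0)⁻¹)) * y ^ (-α) := by
    apply mul_nonneg _ h5.le
    norm_num
    linarith
  nlinarith

/-- For every `α ∈ (0,1)` and every `x > 0`, `0 < x·Φ(x) ≤ 4`. -/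
theorem stmt1 (α : ℝ) (hα : α ∈ Set.Ioo (0:ℝ) 1) (x : ℝ) (hx : 0 < x) :
    0 < x * Phi α x ∧ x * Phi α x ≤ 4 := by
  have hp := Phi_pos α hα x hx.le
  refine ⟨mul_pos hx hp, ?_⟩
  have hb := Phi_le_barrier α hα x hx.le
  have h2 : 0 < 2 + x := by linarith
  calc x * Phi α x ≤ (2 + x) * Phi α x := by nlinarith
    _ ≤ (2 + x) * (4 * (2 + x)⁻¹) := mul_le_mul_of_nonneg_left hb h2.le
    _ = 4 := by field_simp
end

section
/- For every α ∈ (0,1) and every x > 1, the profile function Φ satisfies Φ(x) ≤ Γ(α+2)·(2/x)^{α+1}. -/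
open Real MeasureTheory Set Filter Topology

/-- coefficients of an entire power series -/
def Ent5 (a : ℕ → ℝ) : Prop := ∀ S : ℝ, 0 ≤ S → Summable (fun n => |a n| * S ^ n)

/-- generalized power series -/
noncomputable def G5 (c p : ℝ) (a : ℕ → ℝ) (x : ℝ) : ℝ := ∑' n : ℕ, a n * x ^ (c * n + p)

lemma beta5 (q β x : ℝ) (hq : 0 ≤ q) (hβ : 0 < β) (hx : 0 < x) :
    ∫ y in (0:ℝ)..x, (x - y) ^ (β - 1) * y ^ q
      = x ^ (q + β) * (Gamma (q + 1) * Gamma β / Gamma (q + 1 + β)) := by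
  have h1 := Complex.betaIntegral_scaled ((q + 1 : ℝ) : ℂ) ((β : ℝ) : ℂ) hx
  have h2 := Complex.betaIntegral_eq_Gamma_mul_div ((q + 1 : ℝ) : ℂ) ((β : ℝ) : ℂ)
    (by simp; linarith) (by simpa using hβ)
  rw [h2] at h1
  have h3 : (∫ y in (0:ℝ)..x, (y : ℂ) ^ (((q + 1 : ℝ) : ℂ) - 1) * ((x : ℂ) - y) ^ ((β : ℂ) - 1))
      = ((∫ y in (0:ℝ)..x, (x - y) ^ (β - 1) * y ^ q : ℝ) : ℂ) := by
    rw [← intervalIntegral.integral_ofReal]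
    apply intervalIntegral.integral_congr
    intro y hy
    rw [uIcc_of_le hx.le] at hy
    simp only
    push_cast
    rw [Complex.ofReal_cpow hy.1, Complex.ofReal_cpow (by linarith [hy.2])]
    push_cast
    rw [mul_comm]
    congr 2
    ring
  rw [h3] at h1
  apply Complex.ofReal_injective
  rw [h1, ← Complex.ofReal_add, Complex.Gamma_ofReal, Complex.Gamma_ofReal, Complex.Gamma_ofReal]
  push_cast
  rw [Complex.ofReal_cpow hx.le]
  push_cast
  congr 2
  ring

lemma term5 {c p R y : ℝ} (hc : 0 < c) (hp : 0 ≤ p) (a : ℕ → ℝ) (hy : 0 ≤ y) (hR : y ≤ R) (n : ℕ) :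
    ‖a n * y ^ (c * n + p)‖ ≤ R ^ p * (|a n| * (R ^ c) ^ n) := by
  have hcn : 0 ≤ c * n := by positivity
  rw [norm_mul, Real.norm_eq_abs, Real.norm_eq_abs, abs_of_nonneg (rpow_nonneg hy _)]
  have : y ^ (c * n + p) ≤ R ^ p * (R ^ c) ^ n := by
    rw [← rpow_natCast, ← rpow_mul (hy.trans hR), rpow_add_of_nonneg hy hcn hp, mul_comm]
    have hRp : 0 ≤ R ^ p := rpow_nonneg (hy.trans hR) _
    gcongr
  calc _ ≤ |a n| * (R ^ p * (R ^ c) ^ n) := by gcongr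
    _ = _ := by ring

lemma sumb5 {c p R : ℝ} {a : ℕ → ℝ} (ha : Ent5 a) (hR : 0 ≤ R) :
    Summable (fun n => R ^ p * (|a n| * (R ^ c) ^ n)) :=
  (ha _ (rpow_nonneg hR _)).mul_left _

lemma G5_summable {c p y : ℝ} {a : ℕ → ℝ} (ha : Ent5 a) (hc : 0 < c) (hp : 0 ≤ p) (hy : 0 ≤ y) :
    Summable (fun n : ℕ => a n * y ^ (c * n + p)) :=
  Summable.of_norm_bounded (sumb5 ha hy) (fun n => term5 hc hp a hy le_rfl n)

lemma G5_cont {c p : ℝ} (R : ℝ) {a : ℕ → ℝ} (ha : Ent5 a) (hc : 0 < c) (hp : 0 ≤ p) (hR : 0 ≤ R) :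
    ContinuousOn (G5 c p a) (Icc 0 R) := by
  apply continuousOn_tsum (u := fun n => R ^ p * (|a n| * (R ^ c) ^ n)) _ (sumb5 ha hR)
  · intro n y hy
    exact term5 hc hp a hy.1 hy.2 n
  · intro n
    apply Continuous.continuousOn
    exact continuous_const.mul (continuous_id.rpow_const (fun x => Or.inr (by positivity)))

lemma Ent5_lin {a : ℕ → ℝ} (ha : Ent5 a) {c p : ℝ} (hc : 0 < c) (hp : 0 ≤ p) :
    Ent5 (fun n => (c * n + p) * a n) := by
  intro S hS
  refine Summable.of_nonneg_of_le (fun n => by positivity) ?_ ((ha (2 * S) (by linarith)).mul_left (c + p))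
  intro n
  have h1 : (n : ℝ) ≤ 2 ^ n := by exact_mod_cast (Nat.lt_two_pow_self (n := n)).le
  have h2 : (1 : ℝ) ≤ 2 ^ n := one_le_pow₀ (by norm_num)
  have h3 : c * n + p ≤ (c + p) * 2 ^ n := by nlinarith
  rw [abs_mul, abs_of_nonneg (by positivity : 0 ≤ c * n + p), mul_pow]
  calc _ ≤ (c + p) * 2 ^ n * |a n| * S ^ n := by gcongr
    _ = _ := by ring

lemma Ent5_shift {a : ℕ → ℝ} (ha : Ent5 a) : Ent5 (fun n => a (n + 1)) := by
  intro S hS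
  rcases hS.eq_or_lt with rfl | hS
  · refine summable_of_ne_finset_zero (s := {0}) ?_
    intro n hn
    simp at hn
    simp [hn]
  · have := ((summable_nat_add_iff 1).2 (ha S hS.le)).mul_left S⁻¹
    refine this.congr ?_
    intro n
    field_simp
    ring

lemma G5_deriv {c p x : ℝ} {a : ℕ → ℝ} (ha : Ent5 a) (hc : 0 < c) (hp : 0 ≤ p) (hx : 0 < x) :
    HasDerivAt (G5 c p a) (G5 c (p - 1) (fun n => (c * n + p) * a n) x) x := by
  have hsum := ((sumb5 (c := c) (p := p) (R := 2 * x) (Ent5_lin ha hc hp) (by linarith)).mul_left (x / 2)⁻¹)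
  have key := hasDerivAt_tsum_of_isPreconnected (t := Ioo (x / 2) (2 * x))
    (g := fun (n : ℕ) y => a n * y ^ (c * n + p))
    (g' := fun (n : ℕ) y => ((c * n + p) * a n) * y ^ (c * n + (p - 1))) (y₀ := x) (y := x)
    hsum isOpen_Ioo isPreconnected_Ioo ?_ ?_ ⟨by linarith, by linarith⟩
    (G5_summable ha hc hp hx.le) ⟨by linarith, by linarith⟩
  · exact key
  · intro n y hy
    have hy0 : 0 < y := by linarith [hy.1]
    have := (Real.hasDerivAt_rpow_const (x := y) (p := c * n + p) (Or.inl hy0.ne')).const_mul (a n)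
    convert! this using 1
    rw [show c * n + (p - 1) = c * n + p - 1 by ring]
    ring
  · intro n y hy
    have hy0 : 0 < y := by linarith [hy.1]
    have := term5 hc hp (fun n => (c * n + p) * a n) hy0.le hy.2.le n
    rw [show c * n + (p - 1) = c * n + p - 1 by ring, rpow_sub_one hy0.ne', ← mul_div_assoc,
      norm_div, Real.norm_of_nonneg hy0.le, div_eq_inv_mul]
    have h2 : y⁻¹ ≤ (x / 2)⁻¹ := by
      apply inv_anti₀ (by linarith) hy.1.le
    exact mul_le_mul h2 this (norm_nonneg _) (by positivity)

lemma ker5_int (β x a b : ℝ) (hβ : 0 < β) :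
    IntervalIntegrable (fun y => (x - y) ^ (β - 1)) volume a b := by
  have := (intervalIntegral.intervalIntegrable_rpow' (a := x - a) (b := x - b) (r := β - 1) (by linarith)).comp_sub_left x
  simpa using this

lemma G5_J {c p β x : ℝ} {a : ℕ → ℝ} (ha : Ent5 a) (hc : 0 < c) (hp : 0 ≤ p) (hβ : 0 < β) (hx : 0 < x) :
    ∫ y in (0:ℝ)..x, (x - y) ^ (β - 1) * G5 c p a y
      = G5 c (p + β) (fun n => a n * (Gamma (c * n + p + 1) * Gamma β / Gamma (c * n + p + 1 + β))) x := by
  have hs : ∀ y : ℝ, 0 ≤ y → Summable (fun n : ℕ => a n * y ^ (c * n + p)) := fun y hy =>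
    G5_summable ha hc hp hy
  have key := intervalIntegral.hasSum_integral_of_dominated_convergence (μ := volume) (a := 0) (b := x)
    (F := fun (n : ℕ) y => (x - y) ^ (β - 1) * (a n * y ^ (c * n + p)))
    (f := fun y => (x - y) ^ (β - 1) * G5 c p a y)
    (fun n y => (x - y) ^ (β - 1) * (x ^ p * (|a n| * (x ^ c) ^ n)))
    ?_ ?_ ?_ ?_ ?_
  · rw [← key.tsum_eq, G5]
    congr 1
    ext n
    have hq : 0 ≤ c * n + p := by positivity
    rw [show c * n + (p + β) = c * n + p + β by ring]
    have := beta5 (c * n + p) β x hq hβ hx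
    calc _ = ∫ y in (0:ℝ)..x, a n * ((x - y) ^ (β - 1) * y ^ (c * n + p)) := by
          congr 1; ext y; ring
      _ = _ := by
          rw [intervalIntegral.integral_const_mul, this]; ring
  · intro n
    apply Measurable.aestronglyMeasurable
    fun_prop
  · intro n
    refine Eventually.of_forall fun y hy => ?_
    rw [uIoc_of_le hx.le] at hy
    rw [norm_mul, Real.norm_of_nonneg (rpow_nonneg (by linarith [hy.2]) _)]
    exact mul_le_mul_of_nonneg_left (term5 hc hp a hy.1.le hy.2 n) (rpow_nonneg (by linarith [hy.2]) _)
  · exact Eventually.of_forall fun y hy => (sumb5 ha hx.le).mul_left _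
  · simp_rw [tsum_mul_left]
    exact (ker5_int β x 0 x hβ).mul_const _
  · refine Eventually.of_forall fun y hy => ?_
    rw [uIoc_of_le hx.le] at hy
    exact (hs y hy.1.le).hasSum.mul_left _

/-- Maximum principle. -/
lemma MP5 (α x₀ g : ℝ) (W : ℝ → ℝ) (h0 : 0 < α) (h1 : α < 1) (hx : 0 < x₀)
    (hW : ContinuousOn W (Icc 0 x₀)) (hd : DifferentiableAt ℝ W x₀)
    (hmin : ∀ y ∈ Icc 0 x₀, W x₀ ≤ W y)
    (hJ : HasDerivAt (fun x => ∫ y in (0:ℝ)..x, (x - y) ^ ((1 - α) - 1) * W y) g x₀) :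
    g ≤ W x₀ * x₀ ^ (-α) := by
  set m := W x₀ with hm
  set β := 1 - α with hβ
  have hβ0 : 0 < β := by linarith
  -- Lipschitz bound near x₀
  obtain ⟨L, hL⟩ : ∃ L, ∀ᶠ y in 𝓝 x₀, ‖W y - W x₀‖ ≤ L * ‖y - x₀‖ :=
    hd.hasDerivAt.isBigO_sub.bound
  have hII : ∀ x ∈ Icc 0 x₀, ∀ a ∈ Icc 0 x₀, ∀ b ∈ Icc 0 x₀,
      IntervalIntegrable (fun y => (x - y) ^ (β - 1) * (W y - m)) volume a b := by
    intro x hx' a ha b hb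
    apply (ker5_int β x a b hβ0).mul_continuousOn
    have : uIcc a b ⊆ Icc 0 x₀ := by
      rw [uIcc]; exact Icc_subset_Icc (le_inf ha.1 hb.1) (sup_le ha.2 hb.2)
    exact (hW.mono this).sub continuousOn_const
  have hsplit : ∀ x ∈ Ioc 0 x₀, (∫ y in (0:ℝ)..x, (x - y) ^ (β - 1) * W y)
      = (∫ y in (0:ℝ)..x, (x - y) ^ (β - 1) * (W y - m)) + m * (x ^ β / β) := by
    intro x hx'
    have hi : ∫ y in (0:ℝ)..x, (x - y) ^ (β - 1) * m = m * (x ^ β / β) := by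
      rw [intervalIntegral.integral_mul_const, intervalIntegral.integral_comp_sub_left (fun y => y ^ (β - 1)),
        integral_rpow (Or.inl (by linarith))]
      simp [hβ0.ne']
      ring
    rw [← hi, ← intervalIntegral.integral_add]
    · congr 1; ext y; ring
    · exact hII x ⟨hx'.1.le, hx'.2⟩ 0 ⟨le_rfl, hx.le⟩ x ⟨hx'.1.le, hx'.2⟩
    · exact (ker5_int β x 0 x hβ0).mul_const _
  have hpow : HasDerivAt (fun x : ℝ => m * (x ^ β / β)) (m * x₀ ^ (-α)) x₀ := by
    have := ((Real.hasDerivAt_rpow_const (x := x₀) (p := β) (Or.inl hx.ne')).div_const β).const_mul m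
    convert! this using 1
    rw [show β - 1 = -α by rw [hβ]; ring]
    field_simp
  have hD := hJ.sub hpow
  have hD' := hD.hasDerivWithinAt (s := Iio x₀)
  rw [hasDerivWithinAt_iff_tendsto_slope' (by simp)] at hD'
  have hlim : Tendsto (fun y => L * (x₀ - y) ^ β) (𝓝[<] x₀) (𝓝 0) := by
    have : ContinuousAt (fun y => L * (x₀ - y) ^ β) x₀ := by
      apply ContinuousAt.mul continuousAt_const
      apply ContinuousAt.rpow_const (by fun_prop) (Or.inr hβ0.le)
    have h := this.tendsto
    simp [hβ0.ne'] at h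
    exact h.mono_left nhdsWithin_le_nhds
  have hfin := le_of_tendsto_of_tendsto hD' hlim ?_
  · linarith
  obtain ⟨δ, hδ, hLδ⟩ := Metric.eventually_nhds_iff.1 hL
  filter_upwards [self_mem_nhdsWithin, nhdsWithin_le_nhds (Ioi_mem_nhds hx),
    nhdsWithin_le_nhds (Metric.ball_mem_nhds x₀ hδ)] with z hz hz0 hzδ
  simp only [mem_Iio] at hz
  simp only [mem_Ioi] at hz0
  have hz1 : z ∈ Icc 0 x₀ := ⟨hz0.le, hz.le⟩
  have hx1 : x₀ ∈ Icc 0 x₀ := ⟨hx.le, le_rfl⟩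
  have h01 : (0:ℝ) ∈ Icc 0 x₀ := ⟨le_rfl, hx.le⟩
  rw [slope_comm, slope_def_field]
  simp only [Pi.sub_apply]
  rw [hsplit x₀ ⟨hx, le_rfl⟩, hsplit z ⟨hz0, hz.le⟩, add_sub_cancel_right, add_sub_cancel_right,
    div_le_iff₀ (by linarith),
    ← intervalIntegral.integral_add_adjacent_intervals (hII x₀ hx1 0 h01 z hz1) (hII x₀ hx1 z hz1 x₀ hx1)]
  have hA : ∫ y in (0:ℝ)..z, (x₀ - y) ^ (β - 1) * (W y - m) ≤ ∫ y in (0:ℝ)..z, (z - y) ^ (β - 1) * (W y - m) := by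
    apply intervalIntegral.integral_mono_on_of_le_Ioo hz0.le (hII x₀ hx1 0 h01 z hz1) (hII z hz1 0 h01 z hz1)
    intro y hy
    have hy0 : 0 ≤ W y - m := sub_nonneg.2 (hmin y ⟨hy.1.le, by linarith [hy.2]⟩)
    apply mul_le_mul_of_nonneg_right _ hy0
    apply Real.rpow_le_rpow_of_nonpos (by linarith [hy.2]) (by linarith) (by linarith)
  have hB : ∫ y in z..x₀, (x₀ - y) ^ (β - 1) * (W y - m) ≤ ∫ y in z..x₀, L * (x₀ - z) ^ β := by
    apply intervalIntegral.integral_mono_on_of_le_Ioo hz.le (hII x₀ hx1 z hz1 x₀ hx1) (by simp)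
    intro y hy
    have hd1 : dist y x₀ < δ := by
      rw [Metric.mem_ball] at hzδ
      rw [Real.dist_eq, abs_of_nonpos (by linarith [hy.2])]
      rw [Real.dist_eq, abs_of_nonpos (by linarith [hy.2])] at hzδ
      linarith [hy.1]
    have h3 := (le_abs_self _).trans (hLδ hd1)
    rw [Real.norm_eq_abs, abs_of_nonpos (by linarith [hy.2] : y - x₀ ≤ 0)] at h3
    have hpos : 0 < x₀ - y := by linarith [hy.2]
    have hL0 : 0 ≤ L := by
      have := (abs_nonneg _).trans (hLδ hd1)
      rw [Real.norm_eq_abs, abs_of_nonpos (by linarith [hy.2] : y - x₀ ≤ 0)] at this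
      by_contra hneg
      nlinarith
    calc (x₀ - y) ^ (β - 1) * (W y - m) ≤ (x₀ - y) ^ (β - 1) * (L * (x₀ - y)) := by
          apply mul_le_mul_of_nonneg_left (by linarith) (rpow_nonneg hpos.le _)
      _ = L * (x₀ - y) ^ β := by
          rw [rpow_sub_one hpos.ne']; field_simp
      _ ≤ _ := by
          apply mul_le_mul_of_nonneg_left _ hL0
          exact Real.rpow_le_rpow hpos.le (by linarith [hy.1]) hβ0.le
  rw [intervalIntegral.integral_const, smul_eq_mul] at hB
  nlinarith

noncomputable def cf5 (α : ℝ) (n : ℕ) : ℝ := bCoef α n * (-1 / (1 + α)) ^ n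

lemma Gamma_ratio5 {α s : ℝ} (h0 : 0 < α) (h1 : α < 1) (hs : 1 < s) :
    Gamma s / Gamma (s + α) ≤ (s + α - 1) ^ (-α) := by
  have hA : 0 < Gamma (s + α - 1) := Gamma_pos_of_pos (by linarith)
  have hB : 0 < Gamma (s + α) := Gamma_pos_of_pos (by linarith)
  have h := Real.Gamma_mul_add_mul_le_rpow_Gamma_mul_rpow_Gamma (s := s + α) (t := s + α - 1)
    (a := 1 - α) (b := α) (by linarith) (by linarith) (by linarith) h0 (by ring)
  rw [show (1 - α) * (s + α) + α * (s + α - 1) = s by ring] at h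
  have hG : Gamma (s + α) = (s + α - 1) * Gamma (s + α - 1) := by
    have := Real.Gamma_add_one (s := s + α - 1) (by linarith)
    rw [← this]; congr 1; ring
  rw [div_le_iff₀ hB]
  refine h.trans (le_of_eq ?_)
  rw [hG, Real.mul_rpow (by linarith) hA.le, Real.rpow_sub hA, Real.rpow_sub (by linarith), Real.rpow_neg (by linarith),
    Real.rpow_one, Real.rpow_one]
  have : 0 < (s + α - 1) ^ α := rpow_pos_of_pos (by linarith) _
  have : 0 < (Gamma (s + α - 1)) ^ α := rpow_pos_of_pos hA _
  field_simp

lemma bCoef_pos5 {α : ℝ} (h0 : 0 < α) (n : ℕ) : 0 < bCoef α n := by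
  apply Finset.prod_pos
  intro i _
  exact div_pos (Gamma_pos_of_pos (by positivity)) (Gamma_pos_of_pos (by positivity))

lemma bCoef_succ5 {α : ℝ} (n : ℕ) :
    bCoef α (n + 1) = bCoef α n * (Gamma (α * n + n + 2) / Gamma (α * n + n + 2 + α)) := by
  rw [bCoef, Finset.prod_range_succ, ← bCoef]
  congr 3
  ring

lemma cf5_ent {α : ℝ} (h0 : 0 < α) (h1 : α < 1) : Ent5 (cf5 α) := by
  intro S hS
  rcases hS.eq_or_lt with rfl | hS
  · refine summable_of_ne_finset_zero (s := {0}) ?_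
    intro n hn
    simp at hn
    simp [hn]
  have hb := fun n => bCoef_pos5 h0 n
  have habs : ∀ n, |cf5 α n| * S ^ n = bCoef α n * (S / (1 + α)) ^ n := by
    intro n
    rw [cf5, abs_mul, abs_of_pos (hb n), abs_pow, abs_div, abs_neg, abs_one, abs_of_pos (by linarith : 0 < 1 + α),
      mul_assoc, ← mul_pow]
    congr 2
    ring
  simp_rw [habs]
  have hT : 0 < S / (1 + α) := by positivity
  set T := S / (1 + α)
  apply summable_of_ratio_test_tendsto_lt_one (l := 0) (by norm_num)
  · exact Eventually.of_forall fun n => (mul_pos (hb n) (pow_pos hT n)).ne'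
  have hr : ∀ n : ℕ, ‖bCoef α (n + 1) * T ^ (n + 1)‖ / ‖bCoef α n * T ^ n‖
      = Gamma (α * n + n + 2) / Gamma (α * n + n + 2 + α) * T := by
    intro n
    have := hb n
    rw [Real.norm_of_nonneg (mul_pos (hb _) (pow_pos hT _)).le, Real.norm_of_nonneg (mul_pos (hb _) (pow_pos hT _)).le,
      bCoef_succ5, pow_succ]
    field_simp
  simp_rw [hr]
  have hlim : Tendsto (fun n : ℕ => (α * n + n + 2 + α - 1) ^ (-α) * T) atTop (𝓝 0) := by
    rw [← zero_mul T]
    apply Tendsto.mul_const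
    apply (tendsto_rpow_neg_atTop h0).comp
    refine tendsto_atTop_mono (f := fun n : ℕ => (n : ℝ)) ?_ tendsto_natCast_atTop_atTop
    intro n
    have : 0 ≤ α * n := by positivity
    linarith
  refine squeeze_zero ?_ ?_ hlim
  · intro n
    exact mul_nonneg (div_nonneg (Gamma_nonneg_of_nonneg (by positivity)) (Gamma_nonneg_of_nonneg (by positivity))) hT.le
  · intro n
    apply mul_le_mul_of_nonneg_right _ hT.le
    apply Gamma_ratio5 h0 h1
    have : 0 ≤ α * n := by positivity
    have : (0:ℝ) ≤ n := by positivity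
    linarith

lemma cf5_succ {α : ℝ} (h0 : 0 < α) (n : ℕ) :
    cf5 α (n + 1) * Gamma ((1 + α) * n + 2 + α) = -1 / (1 + α) * cf5 α n * Gamma ((1 + α) * n + 2) := by
  have hp : 0 < Gamma (α * n + n + 2 + α) := Gamma_pos_of_pos (by positivity)
  rw [cf5, cf5, bCoef_succ5, show (1 + α) * n + 2 = α * n + n + 2 by ring, pow_succ]
  field_simp

lemma Phi_eq5 {α x : ℝ} (h0 : 0 < α) (h1 : α < 1) (hx : 0 ≤ x) :
    Phi α x = 1 + G5 (1 + α) (1 + α) (fun n => cf5 α (n + 1)) x := by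
  have hs := G5_summable (cf5_ent h0 h1) (by linarith : 0 < 1 + α) le_rfl hx
  have h : Phi α x = ∑' n : ℕ, cf5 α n * x ^ ((1 + α) * n + 0) := by
    rw [Phi]
    congr 1
    ext n
    rw [add_zero, Real.rpow_mul hx, Real.rpow_natCast, cf5, mul_assoc, ← mul_pow]
    congr 2
    ring
  rw [h, hs.tsum_eq_zero_add, G5]
  congr 1
  · simp [cf5, bCoef]
  · congr 1
    ext n
    congr 2
    push_cast
    ring

lemma xPhi_eq5 {α x : ℝ} (hx : 0 < x) (h0 : 0 < α) :
    x * Phi α x = G5 (1 + α) 1 (cf5 α) x := by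
  rw [Phi, G5, ← tsum_mul_left]
  congr 1
  ext n
  rw [Real.rpow_add hx ((1 + α) * n), Real.rpow_one, Real.rpow_mul hx.le, Real.rpow_natCast, cf5, div_pow, div_pow, neg_pow (x ^ (1 + α)), neg_pow (1 : ℝ)]
  ring

/-- Abel integral of order `α` of `yΦ`. -/
lemma I5 {α x : ℝ} (h0 : 0 < α) (h1 : α < 1) (hx : 0 < x) :
    ∫ y in (0:ℝ)..x, (x - y) ^ (α - 1) * G5 (1 + α) 1 (cf5 α) y
      = (1 + α) * Gamma α * (1 - Phi α x) := by
  rw [G5_J (cf5_ent h0 h1) (by linarith) (by norm_num) h0 hx, Phi_eq5 h0 h1 hx.le, G5, G5,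
    sub_add_cancel_left, ← tsum_neg, ← tsum_mul_left]
  congr 1
  ext n
  have := cf5_succ h0 n
  have hp : 0 < Gamma ((1 + α) * n + 2 + α) := Gamma_pos_of_pos (by positivity)
  rw [show (1 + α) * (n:ℝ) + 1 + 1 = (1 + α) * n + 2 by ring]
  have h2 : cf5 α n * Gamma ((1 + α) * n + 2) = -(1 + α) * (cf5 α (n + 1) * Gamma ((1 + α) * n + 2 + α)) := by
    rw [this]; field_simp
  have h3 : cf5 α n * (Gamma ((1 + α) * n + 2) * Gamma α / Gamma ((1 + α) * n + 2 + α))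
      = -(1 + α) * cf5 α (n + 1) * Gamma α := by
    field_simp
    linear_combination h2
  rw [h3]
  ring

/-- Fractional integral of `Φ - 1`, derivative. -/
lemma J5 {α x : ℝ} (h0 : 0 < α) (h1 : α < 1) (hx : 0 < x) :
    HasDerivAt (fun x => ∫ y in (0:ℝ)..x, (x - y) ^ ((1 - α) - 1) * G5 (1 + α) (1 + α) (fun n => cf5 α (n + 1)) y)
      (-(Gamma (1 - α) / (1 + α)) * (x * Phi α x)) x := by
  have hd := Ent5_shift (cf5_ent h0 h1)
  have hK : 0 < Gamma (1 - α) := Gamma_pos_of_pos (by linarith)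
  have hco : ∀ n : ℕ, cf5 α (n + 1) * (Gamma ((1 + α) * n + (1 + α) + 1) * Gamma (1 - α) / Gamma ((1 + α) * n + (1 + α) + 1 + (1 - α)))
      = -(Gamma (1 - α) / (1 + α)) * cf5 α n / ((1 + α) * n + 2) := by
    intro n
    have := cf5_succ h0 n
    have hp : 0 < Gamma ((1 + α) * n + 2) := Gamma_pos_of_pos (by positivity)
    rw [show (1 + α) * (n:ℝ) + (1 + α) + 1 + (1 - α) = (1 + α) * n + 2 + 1 by ring,
      Real.Gamma_add_one (s := (1 + α) * n + 2) (by positivity), show (1 + α) * (n:ℝ) + (1 + α) + 1 = (1 + α) * n + 2 + α by ring,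
      ← mul_div_assoc, ← mul_assoc, this]
    field_simp
  have hent : Ent5 (fun n : ℕ => -(Gamma (1 - α) / (1 + α)) * cf5 α n / ((1 + α) * n + 2)) := by
    intro S hS
    refine Summable.of_nonneg_of_le (fun n => by positivity) ?_ ((cf5_ent h0 h1 S hS).mul_left (Gamma (1 - α) / (1 + α)))
    intro n
    rw [abs_div, abs_mul, abs_neg, abs_of_pos (by positivity : 0 < Gamma (1 - α) / (1 + α)),
      abs_of_pos (by positivity : 0 < (1 + α) * (n:ℝ) + 2), ← mul_assoc]
    apply mul_le_mul_of_nonneg_right _ (by positivity)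
    apply div_le_self (by positivity)
    have : 0 ≤ (1 + α) * (n:ℝ) := by positivity
    linarith
  have hder := G5_deriv (p := 1 + α + (1 - α)) hent (by linarith : 0 < 1 + α) (by linarith) hx
  have heq : (fun x => ∫ y in (0:ℝ)..x, (x - y) ^ ((1 - α) - 1) * G5 (1 + α) (1 + α) (fun n => cf5 α (n + 1)) y)
      =ᶠ[𝓝 x] G5 (1 + α) (1 + α + (1 - α)) (fun n : ℕ => -(Gamma (1 - α) / (1 + α)) * cf5 α n / ((1 + α) * n + 2)) := by
    filter_upwards [Ioi_mem_nhds hx] with z hz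
    rw [G5_J hd (by linarith) (by linarith) (by linarith) hz]
    congr 1
    ext n
    exact hco n
  convert! hder.congr_of_eventuallyEq heq using 1
  rw [xPhi_eq5 hx h0, G5, G5, ← tsum_mul_left]
  congr 1
  ext n
  rw [show 1 + α + (1 - α) = 2 by ring, show (2:ℝ) - 1 = 1 by norm_num]
  have : 0 < (1 + α) * (n:ℝ) + 2 := by positivity
  field_simp

/-- Coefficients of the derivative of the profile. -/
noncomputable def dv5 (α : ℝ) (n : ℕ) : ℝ := ((1 + α) * n + (1 + α)) * cf5 α (n + 1)

lemma dv5_ent {α : ℝ} (h0 : 0 < α) (h1 : α < 1) : Ent5 (dv5 α) :=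
  Ent5_lin (Ent5_shift (cf5_ent h0 h1)) (by linarith) (by linarith)

lemma K5 {α x : ℝ} (h0 : 0 < α) (h1 : α < 1) (hx : 0 < x) :
    ∫ y in (0:ℝ)..x, (x - y) ^ ((1 - α) - 1) * G5 (1 + α) α (dv5 α) y
      = -(Gamma (1 - α) / (1 + α)) * (x * Phi α x) := by
  rw [G5_J (dv5_ent h0 h1) (by linarith) h0.le (by linarith) hx, xPhi_eq5 hx h0, G5, G5, ← tsum_mul_left]
  congr 1
  ext n
  have := cf5_succ h0 n
  have hp : 0 < Gamma ((1 + α) * n + 2) := Gamma_pos_of_pos (by positivity)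
  rw [show (1 + α) * (n:ℝ) + 2 + α = (1 + α) * n + (1 + α) + 1 by ring, Real.Gamma_add_one (by positivity)] at this
  rw [show α + (1 - α) = 1 by ring, show (1 + α) * (n:ℝ) + α + 1 + (1 - α) = (1 + α) * n + 2 by ring,
    show (1 + α) * (n:ℝ) + α + 1 = (1 + α) * n + (1 + α) by ring, dv5, ← mul_assoc]
  congr 1
  rw [← mul_div_assoc, div_eq_iff hp.ne']
  linear_combination Gamma (1 - α) * this

lemma Wder5 {α x : ℝ} (h0 : 0 < α) (h1 : α < 1) (hx : 0 < x) :
    HasDerivAt (G5 (1 + α) (1 + α) (fun n => cf5 α (n + 1))) (G5 (1 + α) α (dv5 α) x) x := by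
  have := G5_deriv (p := 1 + α) (Ent5_shift (cf5_ent h0 h1)) (by linarith : 0 < 1 + α) (by linarith) hx
  rwa [add_sub_cancel_left] at this

lemma G5_zero {c p : ℝ} (hc : 0 < c) (hp : 0 < p) (a : ℕ → ℝ) : G5 c p a 0 = 0 := by
  have h : ∀ n : ℕ, a n * (0:ℝ) ^ (c * n + p) = 0 := by
    intro n
    rw [Real.zero_rpow (by positivity), mul_zero]
  simp [G5, h]

lemma Phi_pos5 {α x : ℝ} (h0 : 0 < α) (h1 : α < 1) (hx : 0 ≤ x) : 0 < Phi α x := by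
  set W := G5 (1 + α) (1 + α) (fun n => cf5 α (n + 1)) with hWdef
  have hcont := G5_cont (p := 1 + α) x (Ent5_shift (cf5_ent h0 h1)) (by linarith : 0 < 1 + α) (by linarith) hx
  obtain ⟨z, hz, hmin⟩ := isCompact_Icc.exists_isMinOn ⟨0, ⟨le_rfl, hx⟩⟩ hcont
  have hmin' : ∀ y ∈ Icc 0 x, W z ≤ W y := fun y hy => hmin hy
  suffices h : -1 < W z by
    rw [Phi_eq5 h0 h1 hx]
    have := hmin' x ⟨hx, le_rfl⟩
    linarith
  by_contra hneg
  push Not at hneg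
  have hz0 : 0 < z := by
    rcases hz.1.eq_or_lt with h | h
    · rw [← h, hWdef, G5_zero (by linarith) (by linarith)] at hneg
      linarith
    · exact h
  have hmp := MP5 α z _ W h0 h1 hz0 (hcont.mono (Icc_subset_Icc_right hz.2))
    (Wder5 h0 h1 hz0).differentiableAt (fun y hy => hmin' y ⟨hy.1, hy.2.trans hz.2⟩) (J5 h0 h1 hz0)
  rw [Phi_eq5 h0 h1 hz0.le] at hmp
  have hp : 0 < z ^ (-α) := rpow_pos_of_pos hz0 _
  have hK : 0 < Gamma (1 - α) / (1 + α) := div_pos (Gamma_pos_of_pos (by linarith)) (by linarith)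
  have e1 : W z * z ^ (-α) < 0 := mul_neg_of_neg_of_pos (by linarith) hp
  have e2 : 0 ≤ (Gamma (1 - α) / (1 + α)) * (z * -(1 + W z)) :=
    mul_nonneg hK.le (mul_nonneg hz0.le (by linarith))
  nlinarith

lemma v_nonpos5 {α x : ℝ} (h0 : 0 < α) (h1 : α < 1) (hx : 0 ≤ x) : G5 (1 + α) α (dv5 α) x ≤ 0 := by
  set v := G5 (1 + α) α (dv5 α) with hv
  have hcont := G5_cont (p := α) x (dv5_ent h0 h1) (by linarith : 0 < 1 + α) h0.le hx
  obtain ⟨z, hz, hmax⟩ := isCompact_Icc.exists_isMaxOn ⟨0, ⟨le_rfl, hx⟩⟩ hcont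
  have hmax' : ∀ y ∈ Icc 0 x, v y ≤ v z := fun y hy => hmax hy
  refine (hmax' x ⟨hx, le_rfl⟩).trans ?_
  by_contra hneg
  push Not at hneg
  have hz0 : 0 < z := by
    rcases hz.1.eq_or_lt with h | h
    · rw [← h, hv, G5_zero (by linarith) h0] at hneg
      exact absurd hneg (lt_irrefl _)
    · exact h
  have hdv := (G5_deriv (p := α) (dv5_ent h0 h1) (by linarith : 0 < 1 + α) h0.le hz0).differentiableAt
  have hJ : HasDerivAt (fun x => ∫ y in (0:ℝ)..x, (x - y) ^ ((1 - α) - 1) * (fun y => - v y) y)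
      ((Gamma (1 - α) / (1 + α)) * (1 * (1 + G5 (1 + α) (1 + α) (fun n => cf5 α (n + 1)) z) + z * v z)) z := by
    have h2 := ((hasDerivAt_id z).mul ((Wder5 h0 h1 hz0).const_add 1)).const_mul (Gamma (1 - α) / (1 + α))
    refine h2.congr_of_eventuallyEq ?_
    filter_upwards [Ioi_mem_nhds hz0] with t ht
    have := K5 h0 h1 (mem_Ioi.1 ht)
    simp only [mul_neg, intervalIntegral.integral_neg]
    rw [this, Phi_eq5 h0 h1 (mem_Ioi.1 ht).le]
    simp
  have hmp := MP5 α z _ (fun y => - v y) h0 h1 hz0 (hcont.mono (Icc_subset_Icc_right hz.2)).neg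
    hdv.neg (fun y hy => neg_le_neg (hmax' y ⟨hy.1, hy.2.trans hz.2⟩)) hJ
  have hpos := Phi_pos5 h0 h1 hz0.le
  rw [Phi_eq5 h0 h1 hz0.le] at hpos
  have hp : 0 < z ^ (-α) := rpow_pos_of_pos hz0 _
  have hK : 0 < Gamma (1 - α) / (1 + α) := div_pos (Gamma_pos_of_pos (by linarith)) (by linarith)
  have e1 : 0 < v z * z ^ (-α) := mul_pos hneg hp
  have e2 := mul_pos hK (add_pos (mul_pos one_pos hpos) (mul_pos hz0 hneg))
  linarith

lemma Phi_anti5 {α x y : ℝ} (h0 : 0 < α) (h1 : α < 1) (hy : 0 ≤ y) (hyx : y ≤ x) : Phi α x ≤ Phi α y := by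
  rw [Phi_eq5 h0 h1 hy, Phi_eq5 h0 h1 (hy.trans hyx)]
  have hcont := G5_cont (p := 1 + α) x (Ent5_shift (cf5_ent h0 h1)) (by linarith : 0 < 1 + α) (by linarith) (hy.trans hyx)
  have := antitoneOn_of_deriv_nonpos (convex_Icc 0 x) hcont
    (fun z hz => by
      rw [interior_Icc] at hz
      exact (Wder5 h0 h1 hz.1).differentiableAt.differentiableWithinAt)
    (fun z hz => by
      rw [interior_Icc] at hz
      rw [(Wder5 h0 h1 hz.1).deriv]
      exact v_nonpos5 h0 h1 hz.1.le)
  have h := this ⟨hy, hyx⟩ ⟨hy.trans hyx, le_rfl⟩ hyx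
  linarith

/-- For every `x > 1`, `Φ(x) ≤ Γ(α+2)·(2/x)^{α+1}`. -/
theorem stmt5 (α : ℝ) (hα : α ∈ Set.Ioo (0:ℝ) 1) (x : ℝ) (hx : 1 < x) :
    Phi α x ≤ Real.Gamma (α + 2) * (2 / x) ^ (α + 1) := by
  obtain ⟨h0, h1⟩ := hα
  have hx0 : 0 < x := by linarith
  have hI := I5 h0 h1 hx0
  have hpos := Phi_pos5 h0 h1 hx0.le
  have hGα : 0 < Gamma α := Gamma_pos_of_pos h0
  have hG2 : 0 < Gamma (α + 2) := Gamma_pos_of_pos (by linarith)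
  have hint : IntervalIntegrable (fun y => (x - y) ^ (α - 1) * G5 (1 + α) 1 (cf5 α) y) volume 0 x := by
    apply (ker5_int α x 0 x h0).mul_continuousOn
    rw [uIcc_of_le hx0.le]
    exact G5_cont (p := 1) x (cf5_ent h0 h1) (by linarith) (by norm_num) hx0.le
  have hint2 : IntervalIntegrable (fun y => (x - y) ^ (α - 1) * y ^ (1:ℝ) * Phi α x) volume 0 x := by
    apply IntervalIntegrable.mul_const
    apply (ker5_int α x 0 x h0).mul_continuousOn
    simp only [Real.rpow_one]
    exact continuousOn_id
  have hle : ∫ y in (0:ℝ)..x, (x - y) ^ (α - 1) * y ^ (1:ℝ) * Phi α x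
      ≤ ∫ y in (0:ℝ)..x, (x - y) ^ (α - 1) * G5 (1 + α) 1 (cf5 α) y := by
    apply intervalIntegral.integral_mono_on_of_le_Ioo hx0.le hint2 hint
    intro y hy
    rw [← xPhi_eq5 hy.1 h0, Real.rpow_one, mul_assoc]
    apply mul_le_mul_of_nonneg_left _ (rpow_nonneg (by linarith [hy.2]) _)
    exact mul_le_mul_of_nonneg_left (Phi_anti5 h0 h1 hy.1.le hy.2.le) hy.1.le
  rw [intervalIntegral.integral_mul_const, beta5 1 α x (by norm_num) h0 hx0, hI,
    show (1:ℝ) + 1 = 2 by norm_num, Real.Gamma_two, one_mul, show (2:ℝ) + α = α + 2 by ring, add_comm 1 α] at hle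
  have hX : 0 < x ^ (α + 1) := rpow_pos_of_pos hx0 _
  have h2 : (α + 1) ≤ 2 ^ (α + 1) := by
    have := one_add_mul_self_le_rpow_one_add (s := 1) (p := α + 1) (by norm_num) (by linarith)
    norm_num at this
    linarith
  rw [Real.div_rpow (by norm_num) hx0.le, ← mul_div_assoc, le_div_iff₀ hX]
  have h3 : x ^ (α + 1) * (Gamma α / Gamma (α + 2)) * Phi α x ≤ (α + 1) * Gamma α :=
    hle.trans (mul_le_of_le_one_right (by positivity) (by linarith))
  have h4 : Phi α x * x ^ (α + 1) ≤ (α + 1) * Gamma (α + 2) := by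
    have e : x ^ (α + 1) * (Gamma α / Gamma (α + 2)) * Phi α x
      = Gamma α * (Phi α x * x ^ (α + 1)) / Gamma (α + 2) := by ring
    rw [e, div_le_iff₀ hG2] at h3
    apply le_of_mul_le_mul_left _ hGα
    linarith
  nlinarith
end

section
/- For every α ∈ (0,1) and every x ∈ [0,1], the derivative of the profile function Φ satisfies |Φ′(x)| ≤ x^α / Γ(1+α). -/
open Real MeasureTheory Set Filter Topology

lemma aux_beta (s a : ℝ) (hs : 0 < s) (ha : 0 < a) :
    IntervalIntegrable (fun x : ℝ => x ^ (s - 1) * (1 - x) ^ (a - 1)) volume 0 1 ∧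
    ∫ x in (0:ℝ)..1, x ^ (s - 1) * (1 - x) ^ (a - 1)
      = Real.Gamma s * Real.Gamma a / Real.Gamma (s + a) := by
  have hconv := Complex.betaIntegral_convergent (u := (s : ℂ)) (v := (a : ℂ)) (by simpa) (by simpa)
  have hEq : ∀ x ∈ Set.uIoc (0:ℝ) 1,
      (x : ℂ) ^ ((s : ℂ) - 1) * (1 - (x : ℂ)) ^ ((a : ℂ) - 1)
        = ((x ^ (s - 1) * (1 - x) ^ (a - 1) : ℝ) : ℂ) := by
    intro x hx
    rw [Set.uIoc_of_le zero_le_one] at hx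
    rw [Complex.ofReal_mul, Complex.ofReal_cpow hx.1.le,
      Complex.ofReal_cpow (sub_nonneg.2 hx.2)]
    push_cast
    rfl
  have hint : IntervalIntegrable
      (fun x : ℝ => ((x ^ (s - 1) * (1 - x) ^ (a - 1) : ℝ) : ℂ)) volume 0 1 :=
    hconv.congr (fun x hx => hEq x hx)
  have hre : IntervalIntegrable (fun x : ℝ => x ^ (s - 1) * (1 - x) ^ (a - 1)) volume 0 1 := by
    have h1 : Integrable (fun x : ℝ => x ^ (s - 1) * (1 - x) ^ (a - 1))
        (volume.restrict (Set.Ioc (0:ℝ) 1)) := by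
      simpa using hint.1.re
    exact (intervalIntegrable_iff_integrableOn_Ioc_of_le zero_le_one).2 h1
  refine ⟨hre, ?_⟩
  have h1 := ProbabilityTheory.beta_eq_betaIntegralReal s a hs ha
  rw [ProbabilityTheory.beta] at h1
  rw [h1, Complex.betaIntegral, intervalIntegral.integral_congr_ae (g := fun x : ℝ =>
    ((x ^ (s - 1) * (1 - x) ^ (a - 1) : ℝ) : ℂ)) (Filter.Eventually.of_forall hEq),
    intervalIntegral.integral_ofReal, Complex.ofReal_re]

noncomputable def rr (α : ℝ) (n : ℕ) : ℝ :=
  Real.Gamma (α * n + n + 2) / Real.Gamma (α * (n + 1) + n + 2)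

lemma rr_eq (α : ℝ) (hα : 0 < α) (n : ℕ) :
    rr α n = (∫ x in (0:ℝ)..1, x ^ (α * n + n + 2 - 1) * (1 - x) ^ (α - 1)) / Real.Gamma α := by
  have hs : 0 < α * n + n + 2 := by positivity
  rw [(aux_beta _ α hs hα).2, rr]
  have := (Real.Gamma_pos_of_pos hα).ne'
  rw [show α * ((n:ℝ) + 1) + n + 2 = α * n + n + 2 + α by ring]
  field_simp

lemma rr_pos (α : ℝ) (hα : 0 < α) (n : ℕ) : 0 < rr α n := by
  unfold rr
  apply div_pos <;> apply Real.Gamma_pos_of_pos <;> positivity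

lemma rr_lt_one (α : ℝ) (hα : 0 < α) (n : ℕ) : rr α n < 1 := by
  unfold rr
  rw [div_lt_one (by apply Real.Gamma_pos_of_pos; positivity)]
  have h : (0:ℝ) ≤ α * n + n := by positivity
  apply Real.Gamma_strictMonoOn_Ici
  · simp only [Set.mem_Ici]; linarith
  · simp only [Set.mem_Ici]; linarith
  · linarith

lemma rr_anti (α : ℝ) (hα : 0 < α) (n : ℕ) : rr α (n + 1) ≤ rr α n := by
  rw [rr_eq α hα, rr_eq α hα]
  apply div_le_div_of_nonneg_right _ (Real.Gamma_pos_of_pos hα).le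
  apply intervalIntegral.integral_mono_on_of_le_Ioo zero_le_one
  · exact (aux_beta _ α (by positivity) hα).1
  · exact (aux_beta _ α (by positivity) hα).1
  · intro x hx
    apply mul_le_mul_of_nonneg_right _ (Real.rpow_nonneg (by linarith [hx.2]) _)
    apply Real.rpow_le_rpow_of_exponent_ge hx.1 hx.2.le
    push_cast
    linarith

lemma rr_convex (α : ℝ) (hα : 0 < α) (n : ℕ) :
    2 * rr α (n + 1) ≤ rr α n + rr α (n + 2) := by
  rw [rr_eq α hα, rr_eq α hα, rr_eq α hα, ← add_div, ← mul_div_assoc]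
  apply div_le_div_of_nonneg_right _ (Real.Gamma_pos_of_pos hα).le
  have hi : ∀ m : ℕ, IntervalIntegrable
      (fun x : ℝ => x ^ (α * m + m + 2 - 1) * (1 - x) ^ (α - 1)) volume 0 1 :=
    fun m => (aux_beta _ α (by positivity) hα).1
  rw [← intervalIntegral.integral_add (hi n) (hi (n + 2)), ← intervalIntegral.integral_const_mul]
  apply intervalIntegral.integral_mono_on_of_le_Ioo zero_le_one
  · exact (hi (n + 1)).const_mul 2
  · exact (hi n).add (hi (n + 2))
  · intro x hx
    rw [← mul_assoc, ← add_mul]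
    apply mul_le_mul_of_nonneg_right _ (Real.rpow_nonneg (by linarith [hx.2]) _)
    have e1 : x ^ (α * ((n + 1 : ℕ) : ℝ) + ((n + 1 : ℕ) : ℝ) + 2 - 1)
        = x ^ (α * n + n + 2 - 1) * x ^ (α + 1) := by
      rw [← Real.rpow_add hx.1]; congr 1; push_cast; ring
    have e2 : x ^ (α * ((n + 2 : ℕ) : ℝ) + ((n + 2 : ℕ) : ℝ) + 2 - 1)
        = x ^ (α * n + n + 2 - 1) * x ^ (α + 1) * x ^ (α + 1) := by
      rw [← Real.rpow_add hx.1, ← Real.rpow_add hx.1]; congr 1; push_cast; ring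
    rw [e1, e2]
    have := Real.rpow_nonneg hx.1.le (α * n + n + 2 - 1)
    nlinarith [mul_nonneg this (sq_nonneg (x ^ (α + 1) - 1))]

/-- Alternating sums of unimodal sequences are bounded by the maximum. -/
lemma alt_unimodal (q : ℕ → ℝ) (C : ℝ) (h0 : ∀ n, 0 ≤ q n) (hC : ∀ n, q n ≤ C)
    (hu : ∀ n, q (n + 1) ≤ q n → q (n + 2) ≤ q (n + 1))
    (hs : Summable (fun n => (-1 : ℝ) ^ n * q n)) :
    |∑' n, (-1 : ℝ) ^ n * q n| ≤ C := by
  have key : ∀ m, (∑ n ∈ Finset.range m, |q (n + 1) - q n|) + q m ≤ 2 * C - q 0 ∧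
      (q m < q (m + 1) → ∑ n ∈ Finset.range m, |q (n + 1) - q n| = q m - q 0) := by
    intro m
    induction m with
    | zero => simp; linarith [hC 0]
    | succ m ih =>
      rw [Finset.sum_range_succ]
      rcases le_or_gt (q (m + 1)) (q m) with h | h
      · rw [abs_of_nonpos (by linarith)]
        exact ⟨by linarith [ih.1], fun h' => absurd (hu m h) (not_le.2 h')⟩
      · rw [abs_of_nonneg (by linarith), ih.2 h]
        exact ⟨by linarith [hC (m + 1)], fun _ => by ring⟩
  have id : ∀ m, 2 * ∑ n ∈ Finset.range (m + 1), (-1 : ℝ) ^ n * q n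
      = q 0 + ∑ n ∈ Finset.range m, (-1 : ℝ) ^ (n + 1) * (q (n + 1) - q n) + (-1) ^ m * q m := by
    intro m
    induction m with
    | zero => simp; ring
    | succ m ih =>
      rw [Finset.sum_range_succ, mul_add, ih, Finset.sum_range_succ]
      ring
  have hb : ∀ m, |∑ n ∈ Finset.range (m + 1), (-1 : ℝ) ^ n * q n| ≤ C := by
    intro m
    have h1 : |∑ n ∈ Finset.range m, (-1 : ℝ) ^ (n + 1) * (q (n + 1) - q n)|
        ≤ ∑ n ∈ Finset.range m, |q (n + 1) - q n| := by
      refine (Finset.abs_sum_le_sum_abs _ _).trans (le_of_eq ?_)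
      refine Finset.sum_congr rfl fun n _ => ?_
      simp [abs_mul]
    have h2 : |(-1 : ℝ) ^ m * q m| = q m := by
      simp [abs_mul, abs_of_nonneg (h0 m)]
    have h3 : |2 * ∑ n ∈ Finset.range (m + 1), (-1 : ℝ) ^ n * q n| ≤ 2 * C := by
      rw [id]
      refine (abs_add_three _ _ _).trans ?_
      rw [h2, abs_of_nonneg (h0 0)]
      linarith [(key m).1]
    rw [abs_mul, abs_two] at h3
    linarith
  have ht := (hs.hasSum.tendsto_sum_nat.comp (tendsto_add_atTop_nat 1)).abs
  exact le_of_tendsto' ht hb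

lemma delta_ratio (d : ℕ → ℝ) (h0 : 0 ≤ d 0) (hc : ∀ n, d n + d (n + 2) ≤ 2 * d (n + 1)) :
    ∀ i n : ℕ, i ≤ n → ((i : ℝ) + 1) * d (n + 1) ≤ ((n : ℝ) + 1) * d (i + 1) := by
  have h1 : ∀ n : ℕ, (n : ℝ) * d (n + 1) ≤ ((n : ℝ) + 1) * d n := by
    intro n
    induction n with
    | zero => simpa using h0
    | succ n ih =>
      push_cast
      have := hc n
      have hn : (0:ℝ) ≤ n := Nat.cast_nonneg n
      nlinarith
  have h2 : Antitone (fun n : ℕ => d (n + 1) / ((n : ℝ) + 1)) := by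
    apply antitone_nat_of_succ_le
    intro n
    rw [div_le_div_iff₀ (by positivity) (by positivity)]
    have := h1 (n + 1)
    push_cast at this ⊢
    linarith
  intro i n hin
  have := h2 hin
  simp only at this
  rw [div_le_div_iff₀ (by positivity) (by positivity)] at this
  linarith

lemma prod_bound (r : ℕ → ℝ) (hpos : ∀ n, 0 < r n) (hlt : ∀ n, r n < 1)
    (hc : ∀ n, 2 * r (n + 1) ≤ r n + r (n + 2)) (k : ℕ) :
    ((k : ℝ) + 1) * (1 - r (k + 1)) * ∏ i ∈ Finset.range k, r (i + 1) ≤ 1 := by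
  have hd := delta_ratio (fun n => 1 - r n) (by linarith [hlt 0]) (fun n => by linarith [hc n])
  set δ := 1 - r (k + 1) with hδ
  have hδ0 : 0 < δ := by linarith [hlt (k + 1)]
  have hδ1 : δ < 1 := by linarith [hpos (k + 1)]
  have hr : ∀ i, i ≤ k → r (i + 1) ≤ 1 - ((i : ℝ) + 1) * δ / ((k : ℝ) + 1) := by
    intro i hi
    have := hd i k hi
    simp only [← hδ] at this
    have h2 : ((i : ℝ) + 1) * δ / ((k : ℝ) + 1) ≤ 1 - r (i + 1) := by
      rw [div_le_iff₀ (by positivity)]; linarith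
    linarith
  rcases lt_or_ge k 3 with hk | hk
  · interval_cases k
    · simp; linarith
    · have h0 := hr 0 (by norm_num)
      norm_num [Finset.prod_range_succ] at h0 ⊢
      nlinarith [sq_nonneg (δ - 1)]
    · have h0 := hr 0 (by norm_num)
      have h1 := hr 1 (by norm_num)
      norm_num [Finset.prod_range_succ] at h0 h1 ⊢
      have h3 : r 1 * r 2 ≤ (1 - δ / 3) * (1 - 2 * δ / 3) :=
        mul_le_mul h0 h1 (hpos 2).le (by linarith)
      have h4 : 3 * δ * (r 1 * r 2) ≤ 3 * δ * ((1 - δ / 3) * (1 - 2 * δ / 3)) :=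
        mul_le_mul_of_nonneg_left h3 (by positivity)
      refine h4.trans ?_
      nlinarith [mul_nonneg hδ0.le (sq_nonneg (δ - 3/5)), sq_nonneg (δ - 3/5), mul_nonneg (sub_nonneg.2 hδ1.le) (sq_nonneg (δ - 3/5))]
  · have hprod : ∀ m, m ≤ k → ∏ i ∈ Finset.range m, r (i + 1)
        ≤ Real.exp (-(δ * m * (m + 1) / (2 * (k + 1)))) := by
      intro m
      induction m with
      | zero => simp
      | succ m ih =>
        intro hm
        rw [Finset.prod_range_succ]
        have h1 := ih (by omega)
        have h2 : r (m + 1) ≤ Real.exp (-(((m : ℝ) + 1) * δ / ((k : ℝ) + 1))) := by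
          refine (hr m (by omega)).trans ?_
          have := Real.add_one_le_exp (-(((m : ℝ) + 1) * δ / ((k : ℝ) + 1)))
          linarith
        refine (mul_le_mul h1 h2 (hpos _).le (Real.exp_pos _).le).trans (le_of_eq ?_)
        rw [← Real.exp_add]
        congr 1
        push_cast
        field_simp
        ring
    have h1 := hprod k le_rfl
    have hk3 : (3:ℝ) ≤ k := by exact_mod_cast hk
    have e : δ * k * (k + 1) / (2 * ((k:ℝ) + 1)) = δ * k / 2 := by field_simp
    rw [e] at h1
    have h2 := Real.add_one_le_exp (δ * k / 2 - 1)
    have h3 : Real.exp (δ * k / 2 - 1) = Real.exp (δ * k / 2) / Real.exp 1 := Real.exp_sub _ _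
    have he : (2.7:ℝ) < Real.exp 1 := lt_trans (by norm_num) Real.exp_one_gt_d9
    rw [h3] at h2
    have h4 : (δ * k / 2) * Real.exp 1 ≤ Real.exp (δ * k / 2) := by
      rw [← le_div_iff₀ (Real.exp_pos 1)]; linarith
    have h5 : ((k:ℝ) + 1) * δ ≤ Real.exp (δ * k / 2) := by
      refine le_trans ?_ h4
      have : 0 ≤ δ * k / 2 := by positivity
      nlinarith
    calc ((k : ℝ) + 1) * δ * ∏ i ∈ Finset.range k, r (i + 1)
        ≤ Real.exp (δ * k / 2) * Real.exp (-(δ * k / 2)) :=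
          mul_le_mul h5 h1 (Finset.prod_nonneg fun i _ => (hpos _).le) (Real.exp_pos _).le
      _ = 1 := by rw [← Real.exp_add]; simp

lemma g_bound (r : ℕ → ℝ) (hpos : ∀ n, 0 < r n) (hlt : ∀ n, r n < 1)
    (hanti : ∀ n, r (n + 1) ≤ r n)
    (hc : ∀ n, 2 * r (n + 1) ≤ r n + r (n + 2)) (y : ℝ) (hy0 : 0 ≤ y) (hy1 : y < 1) :
    |∑' n : ℕ, (∏ i ∈ Finset.range n, r i) * ((n : ℝ) * (-y) ^ (n - 1))| ≤ r 0 := by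
  set b : ℕ → ℝ := fun n => ∏ i ∈ Finset.range n, r i with hb
  have b0 : b 0 = 1 := by simp [hb]
  have bs : ∀ n, b (n + 1) = b n * r n := fun n => Finset.prod_range_succ _ _
  have bpos : ∀ n, 0 < b n := fun n => Finset.prod_pos fun i _ => hpos i
  have ble : ∀ n, b (n + 1) ≤ b n := fun n => by
    rw [bs]; nlinarith [bpos n, hlt n]
  have bone : ∀ n, b n ≤ 1 := by
    intro n
    induction n with
    | zero => exact b0.le
    | succ n ih => exact (ble n).trans ih
  change |∑' n : ℕ, b n * ((n : ℝ) * (-y) ^ (n - 1))| ≤ r 0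
  have b1 : b 1 = r 0 := by simp [hb]
  rcases hy0.eq_or_lt with rfl | hy
  · rw [tsum_eq_single 1]
    · simp [b1, abs_of_pos (hpos 0)]
    · intro n hn
      rcases n with _ | _ | n
      · simp
      · simp at hn
      · simp
  have hny : ‖-y‖ < 1 := by simpa [abs_of_pos hy] using hy1
  have hg1 : Summable (fun n : ℕ => (-y) ^ n) := summable_geometric_of_norm_lt_one hny
  have hgn : Summable (fun n : ℕ => y ^ n) := summable_geometric_of_lt_one hy0 hy1
  have hgn1 : Summable (fun n : ℕ => (n : ℝ) * y ^ n) := by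
    simpa using summable_pow_mul_geometric_of_norm_lt_one 1 (r := y)
      (by simpa [abs_of_pos hy] using hy1)
  have sA : Summable (fun n : ℕ => b (n + 1) * (-y) ^ n) := by
    refine Summable.of_norm_bounded hgn fun n => ?_
    rw [norm_mul, norm_pow, norm_neg, Real.norm_of_nonneg hy0, Real.norm_of_nonneg (bpos _).le]
    exact mul_le_of_le_one_left (by positivity) (bone _)
  have sB : Summable (fun n : ℕ => (n : ℝ) * b n * (-y) ^ n) := by
    refine Summable.of_norm_bounded hgn1 fun n => ?_
    rw [norm_mul, norm_mul, norm_pow, norm_neg, Real.norm_of_nonneg hy0,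
      Real.norm_of_nonneg (bpos _).le, Real.norm_of_nonneg (Nat.cast_nonneg n)]
    exact mul_le_mul_of_nonneg_right (mul_le_of_le_one_right (Nat.cast_nonneg n) (bone _))
      (by positivity)
  have sC : Summable (fun n : ℕ => (n : ℝ) * b (n + 1) * (-y) ^ n) := by
    refine Summable.of_norm_bounded hgn1 fun n => ?_
    rw [norm_mul, norm_mul, norm_pow, norm_neg, Real.norm_of_nonneg hy0,
      Real.norm_of_nonneg (bpos _).le, Real.norm_of_nonneg (Nat.cast_nonneg n)]
    exact mul_le_mul_of_nonneg_right (mul_le_of_le_one_right (Nat.cast_nonneg n) (bone _))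
      (by positivity)
  set p : ℕ → ℝ := fun n => b (n + 1) * y ^ n with hp
  set q : ℕ → ℝ := fun n => (n : ℝ) * b n * (1 - r n) * y ^ n with hq
  have ep : ∀ n, (-1 : ℝ) ^ n * p n = b (n + 1) * (-y) ^ n := by
    intro n; rw [hp, neg_pow y]; ring
  have eq : ∀ n, (-1 : ℝ) ^ n * q n = (n : ℝ) * b n * (-y) ^ n - (n : ℝ) * b (n + 1) * (-y) ^ n := by
    intro n; simp only [hq]; rw [neg_pow y, bs]; ring
  have sp : Summable (fun n => (-1 : ℝ) ^ n * p n) := by simpa only [ep] using sA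
  have sq : Summable (fun n => (-1 : ℝ) ^ n * q n) := by simpa only [eq] using sB.sub sC
  have hP : |∑' n, (-1 : ℝ) ^ n * p n| ≤ r 0 := by
    have dec : ∀ n, p (n + 1) ≤ p n := fun n =>
      mul_le_mul (ble _) (pow_le_pow_of_le_one hy0 hy1.le (Nat.le_succ n)) (by positivity)
        (bpos _).le
    refine alt_unimodal p _ (fun n => mul_nonneg (bpos _).le (by positivity)) ?_
      (fun n _ => dec (n + 1)) sp
    intro n
    have := antitone_nat_of_succ_le dec (Nat.zero_le n)
    simpa [hp, b1] using this
  have qpos : ∀ n, 0 < q (n + 1) := by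
    intro n
    have := bpos (n + 1)
    have := hlt (n + 1)
    have h : 0 < 1 - r (n + 1) := by linarith
    simp only [hq]
    positivity
  have q0 : q 0 = 0 := by simp [hq]
  have hQ : |∑' n, (-1 : ℝ) ^ n * q n| ≤ y * r 0 := by
    refine alt_unimodal q _ ?_ ?_ ?_ sq
    · intro n
      rcases n with _ | n
      · exact q0.ge
      · exact (qpos n).le
    · intro n
      rcases n with _ | k
      · rw [q0]; exact mul_nonneg hy0 (hpos 0).le
      · have h1 := prod_bound r hpos hlt hc k
        have h2 : b (k + 1) = (∏ i ∈ Finset.range k, r (i + 1)) * r 0 :=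
          Finset.prod_range_succ' _ _
        have h3 : y ^ k ≤ 1 := pow_le_one₀ hy0 hy1.le
        have h4 : q (k + 1) = (((k : ℝ) + 1) * (1 - r (k + 1)) *
            ∏ i ∈ Finset.range k, r (i + 1)) * (y * r 0 * y ^ k) := by
          simp only [hq]; rw [h2]; push_cast; ring
        rw [h4]
        have h5 : 0 ≤ y * r 0 := mul_nonneg hy0 (hpos 0).le
        calc _ ≤ 1 * (y * r 0 * y ^ k) :=
              mul_le_mul_of_nonneg_right h1 (mul_nonneg h5 (by positivity))
          _ ≤ y * r 0 := by rw [one_mul]; exact mul_le_of_le_one_right h5 h3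
    · intro n hn
      rcases n with _ | n
      · exfalso
        have := qpos 0
        rw [q0] at hn
        simp only [zero_add] at hn this
        linarith
      · have l1 : ((n : ℝ) + 1) * ((n : ℝ) + 3) ≤ ((n : ℝ) + 2) ^ 2 := by nlinarith
        have l2 : b (n + 1) * b (n + 3) ≤ b (n + 2) ^ 2 := by
          rw [bs (n + 2), bs (n + 1)]
          have := hanti (n + 1)
          have h6 := mul_pos (mul_pos (bpos (n + 1)) (bpos (n + 1))) (hpos (n + 1))
          nlinarith [mul_le_mul_of_nonneg_left this h6.le]
        have l3 : (1 - r (n + 1)) * (1 - r (n + 3)) ≤ (1 - r (n + 2)) ^ 2 := by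
          have h7 := hc (n + 1)
          have := hlt (n + 1)
          have := hlt (n + 2)
          have := hlt (n + 3)
          simp only [add_assoc, Nat.reduceAdd] at h7
          have h8 : ((1 - r (n + 1)) + (1 - r (n + 3))) ^ 2 ≤ (2 * (1 - r (n + 2))) ^ 2 :=
            pow_le_pow_left₀ (by linarith) (by linarith) 2
          nlinarith [sq_nonneg (r (n + 1) - r (n + 3))]
        have hl : q (n + 1) * q (n + 3) ≤ q (n + 2) ^ 2 := by
          have := hlt (n + 1)
          have := hlt (n + 3)
          have m1 := mul_le_mul l1 l2 (mul_pos (bpos _) (bpos _)).le (by positivity)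
          have m2 := mul_le_mul m1 l3 (mul_nonneg (by linarith) (by linarith)) (by positivity)
          have m3 := mul_le_mul_of_nonneg_right m2 (by positivity : 0 ≤ y ^ (2 * n + 4))
          simp only [hq]
          push_cast
          calc _ = _ := ?_
            _ ≤ _ := m3
            _ = _ := ?_
          · ring
          · ring
        change q (n + 3) ≤ q (n + 2)
        have hn' : q (n + 2) ≤ q (n + 1) := hn
        have h9 := qpos n
        have h10 : 0 < q (n + 2) := qpos (n + 1)
        by_contra hcon
        push Not at hcon
        nlinarith
  have hmain : (1 + y) * ∑' n : ℕ, b n * ((n : ℝ) * (-y) ^ (n - 1))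
      = ∑' n, (-1 : ℝ) ^ n * p n - ∑' n, (-1 : ℝ) ^ n * q n := by
    have s1 : Summable (fun n : ℕ => ((n : ℝ) + 1) * b (n + 1) * (-y) ^ n) := by
      refine (sC.add sA).congr fun n => ?_
      ring
    have s2 : Summable (fun n : ℕ => b n * ((n : ℝ) * (-y) ^ (n - 1))) := by
      rw [← summable_nat_add_iff 1]
      refine s1.congr fun n => ?_
      simp; ring
    have t1 : ∑' n : ℕ, b n * ((n : ℝ) * (-y) ^ (n - 1))
        = ∑' n : ℕ, ((n : ℝ) + 1) * b (n + 1) * (-y) ^ n := by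
      rw [s2.tsum_eq_zero_add]
      simp only [Nat.cast_zero, zero_mul, mul_zero, zero_add]
      refine tsum_congr fun n => ?_
      simp; ring
    have t2 : y * ∑' n : ℕ, b n * ((n : ℝ) * (-y) ^ (n - 1))
        = - ∑' n : ℕ, (n : ℝ) * b n * (-y) ^ n := by
      rw [← tsum_mul_left, ← tsum_neg]
      refine tsum_congr fun n => ?_
      rcases n with _ | n
      · simp
      · simp only [Nat.add_sub_cancel]
        ring
    rw [add_mul, one_mul, t2, t1]
    simp only [ep, eq]
    rw [sB.tsum_sub sC, ← sub_eq_add_neg, sub_sub_eq_add_sub, ← sA.tsum_add sC]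
    congr 1
    refine tsum_congr fun n => ?_
    ring
  have hfin : (1 + y) * |∑' n : ℕ, b n * ((n : ℝ) * (-y) ^ (n - 1))| ≤ (1 + y) * r 0 := by
    rw [← abs_of_pos (by linarith : 0 < 1 + y), ← abs_mul, abs_of_pos (by linarith : 0 < 1 + y),
      hmain]
    refine (abs_sub _ _).trans ?_
    linarith
  exact le_of_mul_le_mul_left hfin (by linarith)

/-- For every `x ∈ [0,1]`, `|Φ′(x)| ≤ x^α / Γ(1+α)`. -/
theorem stmt6 (α : ℝ) (hα : α ∈ Set.Ioo (0:ℝ) 1) (x : ℝ) (hx : x ∈ Set.Icc (0:ℝ) 1) :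
    |deriv (Phi α) x| ≤ x ^ α / Real.Gamma (1 + α) := by
  obtain ⟨ha, -⟩ := hα
  obtain ⟨hx0, hx1⟩ := hx
  have hb : ∀ n, bCoef α n = ∏ i ∈ Finset.range n, rr α i := fun n => rfl
  have hbpos : ∀ n, 0 ≤ bCoef α n := fun n => by
    rw [hb]; exact Finset.prod_nonneg fun i _ => (rr_pos α ha i).le
  have hb1 : ∀ n, bCoef α n ≤ 1 := fun n => by
    rw [hb]
    exact Finset.prod_le_one (fun i _ => (rr_pos α ha i).le) (fun i _ => (rr_lt_one α ha i).le)
  set y := x ^ (1 + α) / (1 + α) with hy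
  have hy0 : 0 ≤ y := by positivity
  have hy1 : y < 1 := by
    rw [hy, div_lt_one (by linarith)]
    have := Real.rpow_le_one hx0 hx1 (by linarith : 0 ≤ 1 + α)
    linarith
  obtain ⟨R, hyR, hR1⟩ := exists_between hy1
  have hR0 : 0 < R := hy0.trans_lt hyR
  have hF : HasDerivAt (fun z : ℝ => ∑' n : ℕ, bCoef α n * z ^ n)
      (∑' n : ℕ, bCoef α n * ((n : ℝ) * (-y) ^ (n - 1))) (-y) := by
    refine hasDerivAt_tsum_of_isPreconnected (u := fun n : ℕ => (n : ℝ) * R ^ (n - 1))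
      (t := Metric.ball (0:ℝ) R) (y₀ := 0)
      (g' := fun n z => bCoef α n * ((n : ℝ) * z ^ (n - 1))) ?_ Metric.isOpen_ball
      (convex_ball _ _).isPreconnected ?_ ?_ ?_ ?_ ?_
    · have h1 : Summable (fun n : ℕ => (n : ℝ) * R ^ n) := by
        simpa using summable_pow_mul_geometric_of_norm_lt_one 1 (r := R)
          (by simpa [abs_of_pos hR0] using hR1)
      refine (h1.mul_left R⁻¹).congr fun n => ?_
      rcases n with _ | n
      · simp
      · simp only [Nat.add_sub_cancel, pow_succ]
        field_simp
    · intro n z _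
      exact (hasDerivAt_pow n z).const_mul _
    · intro n z hz
      rw [mem_ball_zero_iff] at hz
      rw [norm_mul, norm_mul, norm_pow, Real.norm_of_nonneg (hbpos n),
        Real.norm_of_nonneg (Nat.cast_nonneg n)]
      have h1 : ‖z‖ ^ (n - 1) ≤ R ^ (n - 1) := pow_le_pow_left₀ (norm_nonneg _) hz.le _
      have h2 : (n : ℝ) * ‖z‖ ^ (n - 1) ≤ n * R ^ (n - 1) :=
        mul_le_mul_of_nonneg_left h1 (Nat.cast_nonneg n)
      exact (mul_le_of_le_one_left (by positivity) (hb1 n)).trans h2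
    · simpa using hR0
    · refine summable_of_ne_finset_zero (s := {0}) fun n hn => ?_
      have : n ≠ 0 := by simpa using hn
      simp [this]
    · simpa [abs_of_nonneg hy0] using hyR
  have hin : HasDerivAt (fun t : ℝ => -(t ^ (1 + α)) / (1 + α)) (-x ^ α) x := by
    have h := ((Real.hasDerivAt_rpow_const (x := x) (p := 1 + α)
      (Or.inr (by linarith))).neg).div_const (1 + α)
    refine h.congr_deriv ?_
    have : 1 + α ≠ 0 := by linarith
    rw [add_sub_cancel_left]
    field_simp
  have hF' : HasDerivAt (fun z : ℝ => ∑' n : ℕ, bCoef α n * z ^ n)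
      (∑' n : ℕ, bCoef α n * ((n : ℝ) * (-y) ^ (n - 1))) (-(x ^ (1 + α)) / (1 + α)) := by
    rw [neg_div]; exact hF
  have hD := (hF'.comp x hin).deriv
  have hP : Phi α = (fun z : ℝ => ∑' n : ℕ, bCoef α n * z ^ n) ∘
      (fun t : ℝ => -(t ^ (1 + α)) / (1 + α)) := rfl
  have hg := g_bound (rr α) (rr_pos α ha) (rr_lt_one α ha) (rr_anti α ha) (rr_convex α ha) y hy0 hy1
  have hxa : 0 ≤ x ^ α := Real.rpow_nonneg hx0 _
  have hG := Real.Gamma_pos_of_pos (by linarith : 0 < 1 + α)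
  have hr0 : rr α 0 ≤ 1 / Real.Gamma (1 + α) := by
    have e1 : rr α 0 = 1 / Real.Gamma (1 + α + 1) := by
      unfold rr
      rw [show α * ((0 : ℕ) : ℝ) + ((0 : ℕ) : ℝ) + 2 = 2 by simp,
        show α * (((0 : ℕ) : ℝ) + 1) + ((0 : ℕ) : ℝ) + 2 = 1 + α + 1 by push_cast; ring,
        Real.Gamma_two]
    rw [e1, Real.Gamma_add_one (by linarith)]
    apply one_div_le_one_div_of_le hG
    nlinarith
  rw [hP, hD, abs_mul, abs_neg, abs_of_nonneg hxa]
  calc _ ≤ rr α 0 * x ^ α := mul_le_mul_of_nonneg_right hg hxa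
    _ ≤ (1 / Real.Gamma (1 + α)) * x ^ α := mul_le_mul_of_nonneg_right hr0 hxa
    _ = _ := by ring
end
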